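/- Let q ≥ 2 be an integer and let W be a q-step graphon. If W' is a graphon such that t(H,W') = t(H,W) for every finite simple graph H with at most 4q²−q vertices, then W and W' are weakly isomorphic. -/

import Mathlib

open MeasureTheory
open scoped BigOperators Classical

noncomputable section

abbrev I01 : Type := Set.Icc (0 : ℝ) 1

/-- A kernel: a bounded measurable symmetric function on `[0,1]²`. -/
structure GKernel where
  toFun : I01 → I01 → ℝ
  measurable' : Measurable (Function.uncurry toFun)
  bounded' : ∃ C : ℝ, ∀ x y, |toFun x y| ≤ C
  symm' : ∀ x y, toFun x y = toFun y x

/-- A graphon is a kernel with values in `[0,1]`. -/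
def GKernel.IsGraphon (U : GKernel) : Prop :=
  ∀ x y, U.toFun x y ∈ Set.Icc (0 : ℝ) 1

/-- Homomorphism density of a finite simple graph in a kernel. -/
def homDensity {n : ℕ} (H : SimpleGraph (Fin n)) (U : GKernel) : ℝ :=
  ∫ x : Fin n → I01,
    ∏ e ∈ (Set.toFinite H.edgeSet).toFinset,
      Sym2.lift ⟨fun u v => U.toFun (x u) (x v), fun _ _ => U.symm' _ _⟩ e

/-- Two kernels are weakly isomorphic if all homomorphism densities coincide. -/
def WeaklyIsomorphic (U U' : GKernel) : Prop :=
  ∀ (n : ℕ) (H : SimpleGraph (Fin n)), homDensity H U = homDensity H U'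

/-- `A` is a partition of `[0,1]` into `q` measurable parts of positive measure
on whose pairwise products `U` is constant. -/
def IsStepPartition (U : GKernel) {q : ℕ} (A : Fin q → Set I01) : Prop :=
  (∀ i, MeasurableSet (A i)) ∧
  (∀ i, 0 < volume (A i)) ∧
  Pairwise (fun i j => Disjoint (A i) (A j)) ∧
  (⋃ i, A i) = Set.univ ∧
  (∀ i j, ∃ c : ℝ, ∀ x ∈ A i, ∀ y ∈ A j, U.toFun x y = c)

def HasStepPartition (U : GKernel) (q : ℕ) : Prop :=
  ∃ A : Fin q → Set I01, IsStepPartition U A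

/-- A `q`-step kernel: a step partition into `q` parts exists but none into `q - 1` parts. -/
def IsStepKernel (U : GKernel) (q : ℕ) : Prop :=
  HasStepPartition U q ∧ ¬ HasStepPartition U (q - 1)

/-- The degree of a vertex `x` in a kernel. -/
def GKernel.degree (U : GKernel) (x : I01) : ℝ := ∫ y : I01, U.toFun x y

/-- Density of a rooted graph (roots `R`, non-root vertices `Fin b`) in a kernel,
for a given choice `x` of the roots. -/
def rootedDensity {R : Type} [Fintype R] {b : ℕ}
    (H : SimpleGraph (R ⊕ Fin b)) (U : GKernel) (x : R → I01) : ℝ :=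
  ∫ y : Fin b → I01,
    ∏ e ∈ (Set.toFinite H.edgeSet).toFinset,
      Sym2.lift ⟨fun u v => U.toFun (Sum.elim x y u) (Sum.elim x y v),
        fun _ _ => U.symm' _ _⟩ e

/-- `U` takes the constant value `v` on `A i × A j`. -/
def PartDensityIs (U : GKernel) {q : ℕ} (A : Fin q → Set I01) (i j : Fin q) (v : ℝ) : Prop :=
  ∀ x ∈ A i, ∀ y ∈ A j, U.toFun x y = v

/-- A set of pairwise vertex-disjoint edges. -/
def IsMatchingSet {V : Type} (S : Set (Sym2 V)) : Prop :=
  (∀ e ∈ S, ¬ e.IsDiag) ∧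
  ∀ e ∈ S, ∀ f ∈ S, e ≠ f → ∀ v : V, ¬ (v ∈ e ∧ v ∈ f)

/-- The edges of `S` with both endpoints in `V_i ∪ V_j`, where `V_l` is the set of
vertices with first coordinate `l`. -/
def EdgesIn {q : ℕ} {s : Fin q → ℕ} (S : Set (Sym2 ((l : Fin q) × Fin (s l))))
    (i j : Fin q) : Set (Sym2 ((l : Fin q) × Fin (s l))) :=
  {e ∈ S | ∀ v ∈ e, v.1 = i ∨ v.1 = j}

/-- multi-affine functions supported on edge set `E` -/
def MLs {V : Type} (E : Set (Sym2 V)) : Submodule ℝ ((Sym2 V → ℝ) → ℝ) :=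
  Submodule.span ℝ {f | ∃ S : Finset (Sym2 V), (S : Set (Sym2 V)) ⊆ E ∧ f = fun v => ∏ e ∈ S, v e}

lemma MLs_mono {V : Type} {E E' : Set (Sym2 V)} (h : E ⊆ E') : MLs E ≤ MLs E' := by
  apply Submodule.span_mono
  rintro f ⟨S, hS, rfl⟩
  exact ⟨S, hS.trans h, rfl⟩

lemma MLs_var {V : Type} (e : Sym2 V) : (fun v : Sym2 V → ℝ => v e) ∈ MLs ({e} : Set (Sym2 V)) := by
  apply Submodule.subset_span
  exact ⟨{e}, by simp, by simp⟩

lemma MLs_const {V : Type} (E : Set (Sym2 V)) (c : ℝ) : (fun _ : Sym2 V → ℝ => c) ∈ MLs E := by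
  have h1 : (fun _ : Sym2 V → ℝ => (1:ℝ)) ∈ MLs E := by
    apply Submodule.subset_span
    exact ⟨∅, by simp, by simp⟩
  have := (MLs E).smul_mem c h1
  convert this using 1
  funext v; simp

lemma MLs_mul {V : Type} {E E' : Set (Sym2 V)} (hd : Disjoint E E')
    {f g : (Sym2 V → ℝ) → ℝ} (hf : f ∈ MLs E) (hg : g ∈ MLs E') :
    (fun v => f v * g v) ∈ MLs (E ∪ E') := by
  have h := Submodule.mul_mem_mul hf hg
  rw [MLs, MLs, Submodule.span_mul_span] at h
  refine Submodule.span_mono ?_ h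
  rintro _ ⟨_, ⟨S, hS, rfl⟩, _, ⟨S', hS', rfl⟩, rfl⟩
  refine ⟨S ∪ S', by simp only [Finset.coe_union]; exact Set.union_subset_union hS hS', ?_⟩
  funext v
  have : Disjoint S S' := by
    rw [← Finset.disjoint_coe]
    exact hd.mono hS hS'
  simp only [Pi.mul_apply]
  rw [Finset.prod_union this]

lemma MLs_prod {V ι : Type} (s : Finset ι) (E : ι → Set (Sym2 V)) (f : ι → (Sym2 V → ℝ) → ℝ)
    (hf : ∀ i ∈ s, f i ∈ MLs (E i)) (hd : ∀ i ∈ s, ∀ j ∈ s, i ≠ j → Disjoint (E i) (E j)) :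
    (fun v => ∏ i ∈ s, f i v) ∈ MLs (⋃ i ∈ s, E i) := by
  induction s using Finset.induction_on with
  | empty => simpa using MLs_const _ 1
  | insert a s ha ih =>
    have h2 := ih (fun i hi => hf i (Finset.mem_insert_of_mem hi))
      (fun i hi j hj => hd i (Finset.mem_insert_of_mem hi) j (Finset.mem_insert_of_mem hj))
    have h3 := MLs_mul (E := E a) (E' := ⋃ i ∈ s, E i) ?_ (hf a (Finset.mem_insert_self _ _)) h2
    · simp only [Finset.prod_insert ha]
      refine MLs_mono ?_ h3
      simp
    · rw [Set.disjoint_iUnion₂_right]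
      intro i hi
      exact hd a (Finset.mem_insert_self _ _) i (Finset.mem_insert_of_mem hi)
        (by rintro rfl; exact ha hi)

lemma MLs_sub_const {V : Type} (e : Sym2 V) (c : ℝ) :
    (fun v : Sym2 V → ℝ => v e - c) ∈ MLs ({e} : Set (Sym2 V)) :=
  (MLs _).sub_mem (MLs_var e) (MLs_const _ c)

lemma MLs_sub {V : Type} (e e' : Sym2 V) :
    (fun v : Sym2 V → ℝ => v e - v e') ∈ MLs ({e, e'} : Set (Sym2 V)) :=
  (MLs _).sub_mem (MLs_mono (by simp) (MLs_var e)) (MLs_mono (by simp) (MLs_var e'))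

/-- edge values -/
def ev {V X : Type} (K : X → X → ℝ) (hK : ∀ x y, K x y = K y x) (x : V → X) (e : Sym2 V) : ℝ :=
  Sym2.lift ⟨fun u v => K (x u) (x v), fun _ _ => hK _ _⟩ e

@[simp] lemma ev_mk {V X : Type} (K : X → X → ℝ) (hK : ∀ x y, K x y = K y x) (x : V → X) (u v : V) :
    ev K hK x s(u, v) = K (x u) (x v) := rfl

lemma ev_map {V V' X : Type} (K : X → X → ℝ) (hK : ∀ x y, K x y = K y x) (f : V → V')
    (x : V' → X) (e : Sym2 V) :
    ev K hK x (Sym2.map f e) = ev K hK (x ∘ f) e := by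
  induction e using Sym2.ind with
  | _ u v => rfl

/-- monomial density -/
def mdens (V : Type) [Fintype V] (U : GKernel) (S : Finset (Sym2 V)) : ℝ :=
  ∫ x : V → I01, ∏ e ∈ S, ev U.toFun U.symm' x e

lemma homDensity_eq_mdens {n : ℕ} (H : SimpleGraph (Fin n)) (U : GKernel) :
    homDensity H U = mdens (Fin n) U (Set.toFinite H.edgeSet).toFinset := rfl

lemma mdens_map {V V' : Type} [Fintype V] [Fintype V'] (f : V ≃ V') (U : GKernel)
    (S : Finset (Sym2 V)) :
    mdens V' U (S.map ⟨Sym2.map f, Sym2.map.injective f.injective⟩) = mdens V U S := by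
  unfold mdens
  have h := (volume_measurePreserving_piCongrLeft (fun _ : V' => I01) f)
  rw [← h.integral_comp (MeasurableEquiv.measurableEmbedding _)]
  congr 1
  funext x
  rw [Finset.prod_map]
  apply Finset.prod_congr rfl
  intro e _
  simp only [Function.Embedding.coeFn_mk]
  rw [ev_map]
  congr 1
  funext v
  simp [MeasurableEquiv.piCongrLeft, Equiv.piCongrLeft_apply]

lemma mdens_agree (N : ℕ) (W W' : GKernel)
    (hagree : ∀ n : ℕ, n ≤ N → ∀ H : SimpleGraph (Fin n), homDensity H W' = homDensity H W)
    (V : Type) [Fintype V] (hV : Fintype.card V ≤ N) (S : Finset (Sym2 V))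
    (hS : ∀ e ∈ S, ¬ e.IsDiag) : mdens V W' S = mdens V W S := by
  let f := Fintype.equivFin V
  rw [← mdens_map f, ← mdens_map f]
  set T := S.map ⟨Sym2.map f, Sym2.map.injective f.injective⟩ with hT
  have hTd : ∀ e ∈ T, ¬ e.IsDiag := by
    intro e he
    rw [hT, Finset.mem_map] at he
    obtain ⟨e, he, rfl⟩ := he
    have := hS e he
    revert this
    induction e using Sym2.ind with
    | _ u v => simp
  have := hagree _ hV (SimpleGraph.fromEdgeSet (T : Set (Sym2 (Fin (Fintype.card V)))))
  rw [homDensity_eq_mdens, homDensity_eq_mdens] at this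
  have hE : (Set.toFinite (SimpleGraph.fromEdgeSet
      (T : Set (Sym2 (Fin (Fintype.card V))))).edgeSet).toFinset = T := by
    ext e
    simp only [Set.Finite.mem_toFinset, SimpleGraph.edgeSet_fromEdgeSet]
    constructor
    · intro h; exact h.1
    · intro h; exact ⟨h, hTd e h⟩
  rwa [hE] at this

def Pin {ι : Type} [Fintype ι] (a x : ι → ℝ) : ℝ :=
  ∏ j, ∏ k, if a k < a j then (x j - a k) else 1

lemma Pin_pos {ι : Type} [Fintype ι] (a : ι → ℝ) : 0 < Pin a a := by
  unfold Pin
  refine Finset.prod_pos fun j _ => Finset.prod_pos fun k _ => ?_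
  split_ifs with h
  · linarith
  · norm_num

lemma Pin_eq {ι : Type} [Fintype ι] (a x : ι → ℝ) (hx : ∀ j, ∃ k, x j = a k)
    (hs : ∑ j, x j = ∑ j, a j) (h : Pin a x ≠ 0) : x = a := by
  have hle : ∀ j, a j ≤ x j := by
    intro j
    obtain ⟨k, hk⟩ := hx j
    by_contra hlt
    push Not at hlt
    apply h
    unfold Pin
    refine Finset.prod_eq_zero (Finset.mem_univ j) (Finset.prod_eq_zero (Finset.mem_univ k) ?_)
    rw [if_pos (by rw [← hk]; exact hlt), hk, sub_self]
  have := (Finset.sum_eq_sum_iff_of_le (s := Finset.univ) (fun j _ => hle j)).1 hs.symm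
  funext j
  exact (this j (Finset.mem_univ j)).symm

lemma multi_eq {ι : Type} [Fintype ι] (a b : ι → ℝ) (h : ∀ t, ∏ j, (t - a j) = ∏ j, (t - b j)) :
    (∀ j, ∃ k, b j = a k) ∧ ∑ j, b j = ∑ j, a j := by
  have hp : ∏ j, (Polynomial.X - Polynomial.C (a j)) = ∏ j, (Polynomial.X - Polynomial.C (b j)) := by
    apply Polynomial.funext
    intro t
    simp only [Polynomial.eval_prod, Polynomial.eval_sub, Polynomial.eval_X, Polynomial.eval_C]
    exact h t
  have hr : Finset.univ.val.map a = Finset.univ.val.map b := by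
    have h1 := congrArg Polynomial.roots hp
    have h2 : ∀ c : ι → ℝ, (∏ j, (Polynomial.X - Polynomial.C (c j))).roots
        = Finset.univ.val.map c := by
      intro c
      have := Polynomial.roots_multiset_prod_X_sub_C (Finset.univ.val.map c)
      rw [Multiset.map_map] at this
      exact this
    rwa [h2, h2] at h1
  constructor
  · intro j
    have : b j ∈ Finset.univ.val.map b := Multiset.mem_map_of_mem _ (Finset.mem_univ j)
    rw [← hr] at this
    obtain ⟨k, _, hk⟩ := Multiset.mem_map.1 this
    exact ⟨k, hk.symm⟩
  · have := congrArg Multiset.sum hr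
    exact this.symm

abbrev Pr (q : ℕ) : Type := {p : Fin q × Fin q // p.1 < p.2}

lemma prod_Pr_perm {q : ℕ} (g : Fin q → Fin q → ℝ) (hg : ∀ i j, g i j = g j i)
    (σ : Equiv.Perm (Fin q)) :
    ∏ p : Pr q, g (σ p.1.1) (σ p.1.2) = ∏ p : Pr q, g p.1.1 p.1.2 := by
  have key : ∀ g : Fin q → Fin q → ℝ, ∀ hg : ∀ i j, g i j = g j i,
      ∏ p : Pr q, g p.1.1 p.1.2 = ∏ e : Sym2 (Fin q), if e.IsDiag then 1 else ev g hg id e := by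
    intro g hg
    rw [← Finset.prod_filter_mul_prod_filter_not Finset.univ (fun e : Sym2 (Fin q) => e.IsDiag)]
    rw [Finset.prod_eq_one (s := Finset.univ.filter _) (by intro e he; simp at he; simp [he]), one_mul]
    refine Finset.prod_bij (fun p _ => s(p.1.1, p.1.2)) ?_ ?_ ?_ ?_
    · rintro ⟨⟨i, j⟩, h⟩ _
      simp only [Finset.mem_filter, Finset.mem_univ, true_and, Sym2.mk_isDiag_iff]
      exact ne_of_lt h
    · rintro ⟨⟨i, j⟩, h⟩ _ ⟨⟨i', j'⟩, h'⟩ _ heq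
      simp only [Sym2.eq_iff] at heq
      simp only at h h'
      rcases heq with ⟨rfl, rfl⟩ | ⟨rfl, rfl⟩
      · rfl
      · exact absurd h (not_lt.2 h'.le)
    · intro e he
      induction e using Sym2.ind with
      | _ i j =>
        simp only [Finset.mem_filter, Finset.mem_univ, true_and, Sym2.mk_isDiag_iff] at he
        rcases lt_or_gt_of_ne he with h | h
        · exact ⟨⟨(i, j), h⟩, Finset.mem_univ _, rfl⟩
        · exact ⟨⟨(j, i), h⟩, Finset.mem_univ _, Sym2.eq_swap⟩
    · rintro ⟨⟨i, j⟩, h⟩ _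
      simp only [Sym2.mk_isDiag_iff]
      rw [if_neg (ne_of_lt h)]
      rfl
  rw [key g hg, key (fun i j => g (σ i) (σ j)) (fun i j => hg _ _)]
  refine Fintype.prod_bijective (Sym2.map σ) ?_ _ _ ?_
  · refine ⟨Sym2.map.injective σ.injective, ?_⟩
    intro e
    refine ⟨Sym2.map σ.symm e, ?_⟩
    rw [Sym2.map_map]
    simp
  · intro e
    induction e using Sym2.ind with
    | _ i j => simp

lemma MLs_comap {V V' : Type} (i : V → V') (hi : Function.Injective i) {E : Set (Sym2 V)}
    {f : (Sym2 V → ℝ) → ℝ} (hf : f ∈ MLs E) :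
    (fun v : Sym2 V' → ℝ => f (fun e => v (Sym2.map i e))) ∈ MLs (Sym2.map i '' E) := by
  induction hf using Submodule.span_induction with
  | mem f hf =>
    obtain ⟨S, hS, rfl⟩ := hf
    apply Submodule.subset_span
    refine ⟨S.map ⟨Sym2.map i, Sym2.map.injective hi⟩, ?_, ?_⟩
    · simp only [Finset.coe_map, Function.Embedding.coeFn_mk]
      exact Set.image_mono hS
    · funext v
      rw [Finset.prod_map]
      rfl
  | zero => exact (MLs _).zero_mem
  | add f g _ _ hf hg => exact (MLs _).add_mem hf hg
  | smul c f _ hf => exact (MLs _).smul_mem c hf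

def fsum (V : Type) [Fintype V] {k : ℕ} (β : Fin k → ℝ) (B : Fin k → Fin k → ℝ)
    (hB : ∀ i j, B i j = B j i) (f : (Sym2 V → ℝ) → ℝ) : ℝ :=
  ∑ φ : V → Fin k, (∏ v, β (φ v)) * f (ev B hB φ)

def XX {M Wt : Type} [Fintype M] [Fintype Wt] {k : ℕ} (β : Fin k → ℝ) (B : Fin k → Fin k → ℝ)
    (hB : ∀ i j, B i j = B j i) (T : (Sym2 (M ⊕ Wt) → ℝ) → ℝ) (f : M → Fin k) : ℝ :=
  (∏ m, β (f m)) * ∑ g : Wt → Fin k, (∏ w, β (g w)) * T (ev B hB (Sum.elim f g))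

def RS {M : Type} {k : ℕ} (β : Fin k → ℝ) (B : Fin k → Fin k → ℝ)
    (hB : ∀ i j, B i j = B j i) (r : (Sym2 (M ⊕ Unit) → ℝ) → ℝ) (f : M → Fin k) : ℝ :=
  ∑ z, β z * r (ev B hB (Sum.elim f (fun _ => z)))

def MF {M Wt X : Type} [Fintype X] (T : (Sym2 (M ⊕ Wt) → ℝ) → ℝ) (P : (Sym2 M → ℝ) → ℝ)
    (R : X → (Sym2 (M ⊕ Unit) → ℝ) → ℝ) (v : Sym2 ((M ⊕ Wt) ⊕ X) → ℝ) : ℝ :=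
  (T (fun e => v (Sym2.map Sum.inl e)) * P (fun e => v (Sym2.map (fun m => Sum.inl (Sum.inl m)) e)))
   * ∏ x, R x (fun e => v (Sym2.map (Sum.elim (fun m => Sum.inl (Sum.inl m)) (fun _ => Sum.inr x)) e))

lemma sum_elim_inst {A B C : Type} [Fintype A] [Fintype B] [Fintype C]
    (inst : Fintype (A ⊕ B → C)) (F : (A ⊕ B → C) → ℝ) :
    @Finset.sum _ _ _ (@Finset.univ _ inst) F = ∑ a : A → C, ∑ b : B → C, F (Sum.elim a b) := by
  have : inst = Pi.instFintype := Subsingleton.elim _ _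
  subst this
  rw [← (Equiv.sumArrowEquivProdArrow A B C).symm.sum_comp, Fintype.sum_prod_type]
  rfl

lemma fsum_MF {M Wt X : Type} [Fintype M] [Fintype Wt] [Fintype X] {k : ℕ}
    (β : Fin k → ℝ) (B : Fin k → Fin k → ℝ)
    (hB : ∀ i j, B i j = B j i) (T : (Sym2 (M ⊕ Wt) → ℝ) → ℝ) (P : (Sym2 M → ℝ) → ℝ)
    (R : X → (Sym2 (M ⊕ Unit) → ℝ) → ℝ) :
    fsum ((M ⊕ Wt) ⊕ X) β B hB (MF T P R) =
    ∑ f : M → Fin k, XX β B hB T f * P (ev B hB f) * ∏ x, RS β B hB (R x) f := by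
  unfold fsum
  rw [sum_elim_inst, sum_elim_inst]
  refine Finset.sum_congr rfl fun f _ => ?_
  unfold XX RS
  rw [Finset.mul_sum, Finset.sum_mul, Finset.sum_mul]
  refine Finset.sum_congr rfl fun g _ => ?_
  rw [Finset.prod_univ_sum, Finset.mul_sum, Fintype.piFinset_univ]
  refine Finset.sum_congr rfl fun z _ => ?_
  simp only [MF, ev_map, Fintype.prod_sum_type, Sum.elim_inl, Sum.elim_inr, Finset.prod_mul_distrib]
  have c1 : (Sum.elim (Sum.elim f g) z ∘ Sum.inl) = Sum.elim f g := rfl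
  have c2 : (Sum.elim (Sum.elim f g) z ∘ fun m => Sum.inl (Sum.inl m)) = f := rfl
  have c3 : ∀ x, (Sum.elim (Sum.elim f g) z ∘ (Sum.elim (fun m => Sum.inl (Sum.inl m))
      (fun _ : Unit => Sum.inr x))) = Sum.elim f (fun _ => z x) := by
    intro x; funext y; rcases y with y | y <;> rfl
  have c3' := fun x => congrArg (fun u => ev B hB u) (c3 x)
  have d1 : (fun e => ev B hB (Sum.elim (Sum.elim f g) z ∘ Sum.inl) e) = ev B hB (Sum.elim f g) := by
    rw [c1]
  have d2 : (fun e => ev B hB (Sum.elim (Sum.elim f g) z ∘ fun m => Sum.inl (Sum.inl m)) e) = ev B hB f := by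
    rw [c2]
  simp only [d1, d2, c3]
  ring

lemma MF_mem {M Wt X : Type} [Fintype X] (T : (Sym2 (M ⊕ Wt) → ℝ) → ℝ) (P : (Sym2 M → ℝ) → ℝ)
    (R : X → (Sym2 (M ⊕ Unit) → ℝ) → ℝ)
    (hT : T ∈ MLs {e | ∃ m w, e = s(Sum.inl m, Sum.inr w)})
    (hP : P ∈ MLs {e | ¬ e.IsDiag})
    (hR : ∀ x, R x ∈ MLs {e | ∃ m, e = s(Sum.inl m, Sum.inr ())}) :
    MF T P R ∈ MLs {e | ¬ e.IsDiag} := by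
  have h1 := MLs_comap (Sum.inl : M ⊕ Wt → (M ⊕ Wt) ⊕ X) Sum.inl_injective hT
  have h2 := MLs_comap (fun m => Sum.inl (Sum.inl m) : M → (M ⊕ Wt) ⊕ X)
    (fun a b h => Sum.inl_injective (Sum.inl_injective h)) hP
  have h3 := fun x : X => MLs_comap (Sum.elim (fun m => Sum.inl (Sum.inl m)) (fun _ => Sum.inr x) :
      M ⊕ Unit → (M ⊕ Wt) ⊕ X) (by
        rintro (a | a) (b | b) h <;> simp at h ⊢
        exact h) (hR x)
  have h4 := MLs_prod Finset.univ _ _ (fun x _ => h3 x) (by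
    intro x _ y _ hxy
    rw [Set.disjoint_left]
    rintro _ ⟨_, ⟨m, rfl⟩, rfl⟩ ⟨_, ⟨m', rfl⟩, h⟩
    simp only [Sym2.map_mk, Sum.elim_inl, Sum.elim_inr, Sym2.eq_iff] at h
    rcases h with ⟨_, h⟩ | ⟨h, _⟩
    · exact hxy (Sum.inr_injective h).symm
    · cases h)
  have h5 := MLs_mul ?_ h1 h2
  · have h6 := MLs_mul ?_ h5 h4
    · refine MLs_mono ?_ h6
      rintro e ((⟨_, ⟨m, w, rfl⟩, rfl⟩ | ⟨e, he, rfl⟩) | h)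
      · simp
      · induction e using Sym2.ind with
        | _ a b => simpa using he
      · simp only [Set.mem_iUnion] at h
        obtain ⟨x, _, _, ⟨m, rfl⟩, rfl⟩ := h
        simp
    · rw [Set.disjoint_left]
      rintro e h h'
      simp only [Set.mem_iUnion] at h'
      obtain ⟨x, _, _, ⟨m, rfl⟩, rfl⟩ := h'
      simp only [Sym2.map_mk, Sum.elim_inl, Sum.elim_inr] at h
      rcases h with ⟨_, ⟨m', w, rfl⟩, h⟩ | ⟨e, he, h⟩
      · simp at h
      · induction e using Sym2.ind with
        | _ a b => simp at h
  · rw [Set.disjoint_left]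
    rintro _ ⟨_, ⟨m, w, rfl⟩, rfl⟩ ⟨e, he, h⟩
    induction e using Sym2.ind with
    | _ a b => simp at h

def sepF {q : ℕ} [NeZero q] (A : Fin q → Fin q → ℝ) (l j : Fin q) : Fin q :=
  Classical.epsilon (fun i => A l i ≠ A j i)

lemma sepF_spec {q : ℕ} [NeZero q] (A : Fin q → Fin q → ℝ)
    (htw : ∀ l j, l ≠ j → ∃ i, A l i ≠ A j i) (l j : Fin q) (h : l ≠ j) :
    A l (sepF A l j) ≠ A j (sepF A l j) :=
  Classical.epsilon_spec (htw l j h)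

abbrev MT (q h : ℕ) : Type := (Fin h × Bool) × Fin q
abbrev WT (q : ℕ) : Type := Fin q × Fin q × Bool
abbrev TE (q h : ℕ) : Type := Fin h × Bool × Pr q

def LL {h : ℕ} (a : Fin h) (b : Bool) : Fin h × Bool := (a, !b)
def LR {h : ℕ} [NeZero h] (a : Fin h) (b : Bool) : Fin h × Bool := (if b then a else a + 1, b)

def twit {q h : ℕ} [NeZero q] (A : Fin q → Fin q → ℝ) (τ : TE q h) : WT q :=
  (sepF A τ.2.2.1.1 τ.2.2.1.2, τ.2.2.1.1 + τ.2.2.1.2, τ.2.1)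

def ted {q h : ℕ} [NeZero q] (A : Fin q → Fin q → ℝ) (τ : TE q h) (L : Fin h × Bool) (l : Fin q) :
    Sym2 (MT q h ⊕ WT q) := s(Sum.inl (L, l), Sum.inr (twit A τ))

def tg {q h : ℕ} [NeZero q] [NeZero h] (A : Fin q → Fin q → ℝ) (τ : TE q h)
    (v : Sym2 (MT q h ⊕ WT q) → ℝ) : ℝ :=
  if τ.2.1 = false ∧ τ.1 + 1 = 0 then
    (v (ted A τ (LL τ.1 τ.2.1) τ.2.2.1.1) - v (ted A τ (LL τ.1 τ.2.1) τ.2.2.1.2)) *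
    (v (ted A τ (LR τ.1 τ.2.1) τ.2.2.1.1) - v (ted A τ (LR τ.1 τ.2.1) τ.2.2.1.2))
  else
    (v (ted A τ (LR τ.1 τ.2.1) τ.2.2.1.1) - v (ted A τ (LL τ.1 τ.2.1) τ.2.2.1.2)) *
    (v (ted A τ (LL τ.1 τ.2.1) τ.2.2.1.1) - v (ted A τ (LR τ.1 τ.2.1) τ.2.2.1.2))

def TT {q h : ℕ} [NeZero q] [NeZero h] (A : Fin q → Fin q → ℝ)
    (v : Sym2 (MT q h ⊕ WT q) → ℝ) : ℝ := ∏ τ : TE q h, tg A τ v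

def tE {q h : ℕ} [NeZero q] [NeZero h] (A : Fin q → Fin q → ℝ) (τ : TE q h) :
    Set (Sym2 (MT q h ⊕ WT q)) :=
  {e | ∃ L l, (L = LL τ.1 τ.2.1 ∨ L = LR τ.1 τ.2.1) ∧ (l = τ.2.2.1.1 ∨ l = τ.2.2.1.2) ∧
    e = ted A τ L l}

lemma LL_ne_LR {h : ℕ} [NeZero h] (a : Fin h) (b : Bool) : LL a b ≠ LR a b := by
  intro H
  have := congrArg Prod.snd H
  cases b <;> simp [LL, LR] at this

lemma ted_inj {q h : ℕ} [NeZero q] (A : Fin q → Fin q → ℝ) (τ τ' : TE q h) (L L' : Fin h × Bool)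
    (l l' : Fin q) (H : ted A τ L l = ted A τ' L' l') : L = L' ∧ l = l' ∧ twit A τ = twit A τ' := by
  unfold ted at H
  simp only [Sym2.eq_iff, Sum.inl.injEq, Sum.inr.injEq, Prod.mk.injEq] at H
  rcases H with ⟨⟨h1, h2⟩, h3⟩ | ⟨h1, _⟩
  · exact ⟨h1, h2, h3⟩
  · cases h1

lemma tg_mem {q h : ℕ} [NeZero q] [NeZero h] (A : Fin q → Fin q → ℝ) (τ : TE q h) :
    tg A τ ∈ MLs (tE A τ) := by
  have hlj : τ.2.2.1.1 ≠ τ.2.2.1.2 := ne_of_lt τ.2.2.2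
  have hL := LL_ne_LR τ.1 τ.2.1
  have aux : ∀ L1 L2 L3 L4 l1 l2 l3 l4,
      (L1 = LL τ.1 τ.2.1 ∨ L1 = LR τ.1 τ.2.1) → (L2 = LL τ.1 τ.2.1 ∨ L2 = LR τ.1 τ.2.1) →
      (L3 = LL τ.1 τ.2.1 ∨ L3 = LR τ.1 τ.2.1) → (L4 = LL τ.1 τ.2.1 ∨ L4 = LR τ.1 τ.2.1) →
      (l1 = τ.2.2.1.1 ∨ l1 = τ.2.2.1.2) → (l2 = τ.2.2.1.1 ∨ l2 = τ.2.2.1.2) →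
      (l3 = τ.2.2.1.1 ∨ l3 = τ.2.2.1.2) → (l4 = τ.2.2.1.1 ∨ l4 = τ.2.2.1.2) →
      (L1, l1) ≠ (L3, l3) → (L1, l1) ≠ (L4, l4) → (L2, l2) ≠ (L3, l3) → (L2, l2) ≠ (L4, l4) →
      (fun v : Sym2 (MT q h ⊕ WT q) → ℝ => (v (ted A τ L1 l1) - v (ted A τ L2 l2)) *
        (v (ted A τ L3 l3) - v (ted A τ L4 l4))) ∈ MLs (tE A τ) := by
    intro L1 L2 L3 L4 l1 l2 l3 l4 a1 a2 a3 a4 b1 b2 b3 b4 c1 c2 c3 c4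
    have hh : ∀ (L L' : Fin h × Bool) (l l' : Fin q), (L, l) ≠ (L', l') → ted A τ L l ≠ ted A τ L' l' := by
      intro L L' l l' hne H
      obtain ⟨r1, r2, _⟩ := ted_inj A τ τ L L' l l' H
      exact hne (by rw [r1, r2])
    refine MLs_mono ?_ (MLs_mul ?_ (MLs_sub (ted A τ L1 l1) (ted A τ L2 l2))
      (MLs_sub (ted A τ L3 l3) (ted A τ L4 l4)))
    · rintro e ((rfl | rfl) | (rfl | rfl))
      exacts [⟨_, _, a1, b1, rfl⟩, ⟨_, _, a2, b2, rfl⟩, ⟨_, _, a3, b3, rfl⟩, ⟨_, _, a4, b4, rfl⟩]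
    · rw [Set.disjoint_left]
      rintro e (rfl | rfl) (H | H)
      exacts [hh _ _ _ _ c1 H, hh _ _ _ _ c2 H, hh _ _ _ _ c3 H, hh _ _ _ _ c4 H]
  unfold tg
  by_cases hc : τ.2.1 = false ∧ τ.1 + 1 = 0
  · simp only [if_pos hc]
    apply aux <;> simp [hL, hlj, hL.symm, hlj.symm]
  · simp only [if_neg hc]
    apply aux <;> simp [hL, hlj, hL.symm, hlj.symm]

lemma tE_disj {q h : ℕ} [NeZero q] [NeZero h] (A : Fin q → Fin q → ℝ) (τ τ' : TE q h)
    (hne : τ ≠ τ') : Disjoint (tE A τ) (tE A τ') := by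
  rw [Set.disjoint_left]
  rintro e ⟨L, l, hL, hl, rfl⟩ ⟨L', l', hL', hl', H⟩
  obtain ⟨r1, r2, r3⟩ := ted_inj A _ _ _ _ _ _ H
  subst r1 r2
  obtain ⟨a, b, ⟨⟨i, j⟩, hij⟩⟩ := τ
  obtain ⟨a', b', ⟨⟨i', j'⟩, hij'⟩⟩ := τ'
  simp only [twit, Prod.mk.injEq] at r3 hL hL' hl hl' hij hij'
  obtain ⟨_, hs, rfl⟩ := r3
  have ha : a = a' := by
    cases b
    · rcases hL with rfl | rfl <;> rcases hL' with hL' | hL' <;> simp [LL, LR] at hL' <;> exact hL'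
    · rcases hL with rfl | rfl <;> rcases hL' with hL' | hL' <;> simp [LL, LR] at hL' <;> exact hL'
  subst ha
  apply hne
  have : i = i' ∧ j = j' := by
    rcases hl with rfl | rfl <;> rcases hl' with rfl | rfl
    · exact ⟨rfl, add_left_cancel hs⟩
    · rw [add_comm] at hs
      have := add_right_cancel hs
      subst this
      exact absurd hij (not_lt.2 hij'.le)
    · rw [add_comm] at hs
      have := add_left_cancel hs
      subst this
      exact absurd hij (not_lt.2 hij'.le)
    · exact ⟨add_right_cancel hs, rfl⟩
  obtain ⟨rfl, rfl⟩ := this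
  rfl

lemma TT_mem {q h : ℕ} [NeZero q] [NeZero h] (A : Fin q → Fin q → ℝ) :
    (TT A : (Sym2 (MT q h ⊕ WT q) → ℝ) → ℝ) ∈ MLs {e | ∃ m w, e = s(Sum.inl m, Sum.inr w)} := by
  refine MLs_mono ?_ (MLs_prod Finset.univ (tE A) (tg A) (fun τ _ => tg_mem A τ)
    (fun τ _ τ' _ hne => tE_disj A τ τ' hne))
  intro e he
  simp only [Set.mem_iUnion] at he
  obtain ⟨τ, _, L, l, _, _, rfl⟩ := he
  exact ⟨_, _, rfl⟩

/-- structural consequence of nonvanishing -/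
lemma TT_ne {q h k : ℕ} [NeZero q] [NeZero h] (A : Fin q → Fin q → ℝ) (B : Fin k → Fin k → ℝ)
    (hB : ∀ i j, B i j = B j i) (hk : k ≤ q) (f : MT q h → Fin k) (g : WT q → Fin k)
    (hne : TT A (ev B hB (Sum.elim f g)) ≠ 0) :
    ∃ σ : Fin q → Fin k, Function.Bijective σ ∧ ∀ L l, f (L, l) = σ l := by
  unfold TT at hne
  rw [Finset.prod_ne_zero_iff] at hne
  have h0 : Function.Injective (fun l => f ((0, false), l)) := by
    have : ∀ l j, l < j → f ((0, false), l) ≠ f ((0, false), j) := by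
      intro l j hlj H
      have := hne ((-1 : Fin h), false, ⟨(l, j), hlj⟩) (Finset.mem_univ _)
      unfold tg at this
      rw [if_pos (by simp)] at this
      apply this
      simp [ted, LR, H]
    intro l j H
    by_contra hlj
    rcases lt_or_gt_of_ne hlj with h1 | h1
    · exact this _ _ h1 H
    · exact this _ _ h1 H.symm
  have hkq : q ≤ k := by simpa using Fintype.card_le_of_injective _ h0
  obtain rfl : k = q := le_antisymm hk hkq
  have hbij : Function.Bijective (fun l => f ((0, false), l)) := Finite.injective_iff_bijective.1 h0
  have step : ∀ a b, ¬ (b = false ∧ a + 1 = (0 : Fin h)) → (∀ l, f (LL a b, l) = f ((0, false), l)) →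
      ∀ l, f (LR a b, l) = f ((0, false), l) := by
    intro a b hc hLL l
    obtain ⟨j, hj⟩ := hbij.2 (f (LR a b, l))
    simp only at hj
    by_cases hlj : l = j
    · rw [hlj, ← hlj, ← hj, hlj]
    exfalso
    rw [← hLL] at hj
    rcases lt_or_gt_of_ne hlj with h1 | h1
    · have := hne (a, b, ⟨(l, j), h1⟩) (Finset.mem_univ _)
      unfold tg at this
      rw [if_neg hc] at this
      apply this
      simp [ted, hj]
    · have := hne (a, b, ⟨(j, l), h1⟩) (Finset.mem_univ _)
      unfold tg at this
      rw [if_neg hc] at this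
      apply this
      simp [ted, hj]
  have tr : ∀ a : Fin h, (∀ l, f ((a, false), l) = f ((0, false), l)) →
      (∀ l, f ((a, true), l) = f ((0, false), l)) := by
    intro a ha l
    have := step a true (by simp) (by simpa [LL] using ha) l
    simpa [LR] using this
  have all : ∀ n (hn : n < h), ∀ l, f ((⟨n, hn⟩, false), l) = f ((0, false), l) := by
    intro n
    induction n with
    | zero => intro hn l; rfl
    | succ n ih =>
      intro hn l
      have h1 := tr _ (ih (by omega))
      have e : (⟨n, by omega⟩ : Fin h) + 1 = ⟨n + 1, hn⟩ := by
        apply Fin.ext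
        rw [Fin.val_add_one_of_lt']
        exact hn
      have := step ⟨n, by omega⟩ false (by
        rw [e]; rintro ⟨_, h2⟩
        have := congrArg Fin.val h2
        simp at this) (by simpa [LL] using h1) l
      simpa [LR, e] using this
  refine ⟨_, hbij, ?_⟩
  rintro ⟨a, b⟩ l
  cases b
  · exact all a.1 a.2 l
  · exact tr a (fun l => all a.1 a.2 l) l

lemma tg_eval {q h k : ℕ} [NeZero q] [NeZero h] (A : Fin q → Fin q → ℝ) (B : Fin k → Fin k → ℝ)
    (hB : ∀ i j, B i j = B j i) (f : MT q h → Fin k) (g : WT q → Fin k)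
    (σ : Fin q → Fin k) (hf : ∀ L l, f (L, l) = σ l) (τ : TE q h) :
    tg A τ (ev B hB (Sum.elim f g)) =
      (B (σ τ.2.2.1.1) (g (twit A τ)) - B (σ τ.2.2.1.2) (g (twit A τ))) ^ 2 := by
  unfold tg
  simp only [ted, ev_mk, Sum.elim_inl, Sum.elim_inr, hf]
  split_ifs <;> ring

lemma TT_nonneg {q h : ℕ} [NeZero q] [NeZero h] (A : Fin q → Fin q → ℝ)
    (hA : ∀ i j, A i j = A j i) (f : MT q h → Fin q) (g : WT q → Fin q) :
    0 ≤ TT A (ev A hA (Sum.elim f g)) := by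
  by_contra hlt
  obtain ⟨σ, _, hσ⟩ := TT_ne A A hA le_rfl f g (fun H => hlt H.ge)
  apply hlt
  unfold TT
  refine Finset.prod_nonneg fun τ _ => ?_
  rw [tg_eval A A hA f g σ hσ]
  positivity

lemma TT_pos {q h : ℕ} [NeZero q] [NeZero h] (A : Fin q → Fin q → ℝ)
    (hA : ∀ i j, A i j = A j i) (htw : ∀ l j, l ≠ j → ∃ i, A l i ≠ A j i) :
    0 < TT A (ev A hA (Sum.elim (fun m : MT q h => m.2) (fun w : WT q => w.1))) := by
  unfold TT
  refine Finset.prod_pos fun τ _ => ?_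
  rw [tg_eval A A hA _ _ id (fun _ _ => rfl)]
  have := sepF_spec A htw _ _ (ne_of_lt τ.2.2.2)
  have h2 := sub_ne_zero.2 this
  exact sq_pos_of_ne_zero h2

lemma XX_nonneg {q h : ℕ} [NeZero q] [NeZero h] (α : Fin q → ℝ) (hα : ∀ i, 0 < α i)
    (A : Fin q → Fin q → ℝ) (hA : ∀ i j, A i j = A j i) (f : MT q h → Fin q) :
    0 ≤ XX α A hA (TT A) f := by
  unfold XX
  refine mul_nonneg (Finset.prod_nonneg fun m _ => (hα _).le) (Finset.sum_nonneg fun g _ => ?_)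
  exact mul_nonneg (Finset.prod_nonneg fun m _ => (hα _).le) (TT_nonneg A hA f g)

lemma XX_pos {q h : ℕ} [NeZero q] [NeZero h] (α : Fin q → ℝ) (hα : ∀ i, 0 < α i)
    (A : Fin q → Fin q → ℝ) (hA : ∀ i j, A i j = A j i)
    (htw : ∀ l j, l ≠ j → ∃ i, A l i ≠ A j i) :
    0 < XX α A hA (TT A) (fun m : MT q h => m.2) := by
  unfold XX
  refine mul_pos (Finset.prod_pos fun m _ => (hα _)) (Finset.sum_pos' (fun g _ => ?_)
    ⟨fun w => w.1, @Finset.mem_univ _ (_) _, ?_⟩)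
  · exact mul_nonneg (Finset.prod_nonneg fun m _ => (hα _).le) (TT_nonneg A hA _ g)
  · exact mul_pos (Finset.prod_pos fun m _ => (hα _)) (TT_pos A hA htw)

lemma XX_ne {q h k : ℕ} [NeZero q] [NeZero h] (A : Fin q → Fin q → ℝ) (β : Fin k → ℝ)
    (B : Fin k → Fin k → ℝ)
    (hB : ∀ i j, B i j = B j i) (hk : k ≤ q) (f : MT q h → Fin k)
    (hne : XX β B hB (TT A) f ≠ 0) :
    ∃ σ : Fin q → Fin k, Function.Bijective σ ∧ ∀ L l, f (L, l) = σ l := by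
  unfold XX at hne
  have h1 := right_ne_zero_of_mul hne
  obtain ⟨g, _, hg⟩ := Finset.exists_ne_zero_of_sum_ne_zero h1
  exact TT_ne A B hB hk f g (right_ne_zero_of_mul hg)

lemma MLs_pins {V ι : Type} [Fintype ι] (c : ι → Prop) [DecidablePred c] (e : ι → Sym2 V) (a : ι → ℝ)
    (he : ∀ i j, c i → c j → e i = e j → i = j) :
    (fun v : Sym2 V → ℝ => ∏ i, if c i then v (e i) - a i else 1) ∈ MLs {x | ∃ i, c i ∧ x = e i} := by
  refine MLs_mono ?_ (MLs_prod Finset.univ (fun i => {x | c i ∧ x = e i})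
    (fun i v => if c i then v (e i) - a i else 1) ?_ ?_)
  · intro x hx
    simp only [Set.mem_iUnion] at hx
    obtain ⟨i, _, hi⟩ := hx
    exact ⟨i, hi⟩
  · intro i _
    by_cases hc : c i
    · simp only [hc, if_true, true_and]
      exact MLs_sub_const (e i) (a i)
    · simp only [hc, if_false]
      exact MLs_const _ _
  · intro i _ j _ hij
    rw [Set.disjoint_left]
    rintro x ⟨h1, rfl⟩ ⟨h2, h3⟩
    exact hij (he i j h1 h2 h3)

lemma multi_eq2 {ι : Type} [Fintype ι] (a b : ι → ℝ) (h : ∀ t, ∏ j, (a j - t) = ∏ j, (b j - t)) :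
    (∀ j, ∃ k, b j = a k) ∧ ∑ j, b j = ∑ j, a j := by
  apply multi_eq
  intro t
  have e : ∀ c : ι → ℝ, ∏ j, (t - c j) = (∏ j : ι, (-1 : ℝ)) * ∏ j, (c j - t) := by
    intro c
    rw [← Finset.prod_mul_distrib]
    refine Finset.prod_congr rfl fun j _ => by ring
  rw [e, e, h]

def P1f {q h : ℕ} [NeZero h] (t : ℝ) (v : Sym2 (MT q h) → ℝ) : ℝ :=
  ∏ p : Pr q, if True then v s(((0, false), p.1.1), ((0, false), p.1.2)) - t else 1

def P2f {q h : ℕ} [NeZero h] (t : ℝ) (v : Sym2 (MT q h) → ℝ) : ℝ :=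
  ∏ i : Fin q, if True then v s(((0, false), i), ((0, true), i)) - t else 1

def PPa {q h : ℕ} (A : Fin q → Fin q → ℝ) (lam : Fin q → Fin h × Bool) (v : Sym2 (MT q h) → ℝ) : ℝ :=
  ∏ p : Pr q × Pr q, if A p.2.1.1 p.2.1.2 < A p.1.1.1 p.1.1.2 then
    v s((lam p.2.1.1, p.1.1.1), (lam p.2.1.2, p.1.1.2)) - A p.2.1.1 p.2.1.2 else 1

def PPb {q h : ℕ} (A : Fin q → Fin q → ℝ) (lam : Fin q → Fin h × Bool) (v : Sym2 (MT q h) → ℝ) : ℝ :=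
  ∏ p : Fin q × Fin q, if A p.2 p.2 < A p.1 p.1 then
    v s((lam p.1, p.1), (lam p.2, p.1)) - A p.2 p.2 else 1

lemma P1f_mem {q h : ℕ} [NeZero h] (t : ℝ) :
    (P1f t : (Sym2 (MT q h) → ℝ) → ℝ) ∈ MLs {e | ¬ e.IsDiag} := by
  refine MLs_mono ?_ (MLs_pins (fun _ : Pr q => True) (fun p => (s(((0, false), p.1.1), ((0, false), p.1.2)) : Sym2 (MT q h))) (fun _ => t) ?_)
  · rintro _ ⟨⟨⟨i, j⟩, hij⟩, _, rfl⟩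
    simpa using ne_of_lt hij
  · rintro ⟨⟨i, j⟩, hij⟩ ⟨⟨i', j'⟩, hij'⟩ _ _ H
    simp only [Sym2.eq_iff, Prod.mk.injEq, true_and] at H hij hij'
    rcases H with ⟨rfl, rfl⟩ | ⟨rfl, rfl⟩
    · rfl
    · exact absurd hij (not_lt.2 hij'.le)

lemma P2f_mem {q h : ℕ} [NeZero h] (t : ℝ) :
    (P2f t : (Sym2 (MT q h) → ℝ) → ℝ) ∈ MLs {e | ¬ e.IsDiag} := by
  refine MLs_mono ?_ (MLs_pins (fun _ : Fin q => True) (fun i => (s(((0, false), i), ((0, true), i)) : Sym2 (MT q h))) (fun _ => t) ?_)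
  · rintro _ ⟨i, _, rfl⟩
    simp
  · rintro i j _ _ H
    simpa using H

lemma PP_mem {q h : ℕ} (A : Fin q → Fin q → ℝ) (lam : Fin q → Fin h × Bool)
    (hl : Function.Injective lam) :
    (fun v => PPa A lam v * PPb A lam v) ∈ MLs {e | ¬ e.IsDiag} := by
  have h1 := MLs_pins (fun p : Pr q × Pr q => A p.2.1.1 p.2.1.2 < A p.1.1.1 p.1.1.2)
    (fun p => s((lam p.2.1.1, p.1.1.1), (lam p.2.1.2, p.1.1.2))) (fun p => A p.2.1.1 p.2.1.2) (by
      rintro ⟨⟨⟨i, j⟩, hij⟩, ⟨⟨i1, j1⟩, hij1⟩⟩ ⟨⟨⟨i', j'⟩, hij'⟩, ⟨⟨i1', j1'⟩, hij1'⟩⟩ _ _ H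
      simp only [Sym2.eq_iff, Prod.mk.injEq] at H hij hij'
      rcases H with ⟨⟨h1, rfl⟩, h2, rfl⟩ | ⟨⟨h1, rfl⟩, h2, rfl⟩
      · obtain rfl := hl h1
        obtain rfl := hl h2
        rfl
      · exact absurd hij (not_lt.2 hij'.le))
  have h2 := MLs_pins (fun p : Fin q × Fin q => A p.2 p.2 < A p.1 p.1)
    (fun p => s((lam p.1, p.1), (lam p.2, p.1))) (fun p => A p.2 p.2) (by
      rintro ⟨i, j⟩ ⟨i', j'⟩ _ _ H
      simp only [Sym2.eq_iff, Prod.mk.injEq] at H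
      rcases H with ⟨⟨h1, rfl⟩, h2, _⟩ | ⟨⟨h1, rfl⟩, h2, _⟩
      · obtain rfl := hl h2
        rfl
      · obtain rfl := hl h1
        obtain rfl := hl h2
        rfl)
  refine MLs_mono ?_ (MLs_mul ?_ h1 h2)
  · rintro _ (⟨⟨⟨⟨i, j⟩, hij⟩, ⟨⟨i1, j1⟩, hij1⟩⟩, _, rfl⟩ | ⟨⟨i, j⟩, hc, rfl⟩)
    · simp only [Set.mem_ofPred_eq, Sym2.mk_isDiag_iff, Prod.mk.injEq, not_and]
      intro _; exact ne_of_lt hij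
    · simp only [Set.mem_ofPred_eq, Sym2.mk_isDiag_iff, Prod.mk.injEq, not_and] at hc ⊢
      intro h; obtain rfl := hl h
      exact absurd hc (lt_irrefl _)
  · rw [Set.disjoint_left]
    rintro _ ⟨⟨⟨⟨i, j⟩, hij⟩, ⟨⟨i1, j1⟩, hij1⟩⟩, _, rfl⟩ ⟨⟨i', j'⟩, hc, H⟩
    simp only [Sym2.eq_iff, Prod.mk.injEq] at H hij
    rcases H with ⟨⟨_, h1⟩, _, h2⟩ | ⟨⟨_, h1⟩, _, h2⟩
    · rw [h1, h2] at hij; exact absurd hij (lt_irrefl _)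
    · rw [h1, h2] at hij; exact absurd hij (lt_irrefl _)

def kap {q : ℕ} [NeZero q] (A : Fin q → Fin q → ℝ) (l : Fin q) : ℝ :=
  ∏ j : Fin q, if j ≠ l then A l (sepF A l j) - A j (sepF A l j) else 1

def Rf {q h : ℕ} [NeZero q] (A : Fin q → Fin q → ℝ) (lam : Fin q → Fin h × Bool) (l : Fin q) (s : ℝ)
    (v : Sym2 (MT q h ⊕ Unit) → ℝ) : ℝ :=
  (kap A l)⁻¹ * (∏ j : Fin q, if j ≠ l then
    v s(Sum.inl (lam j, sepF A l j), Sum.inr ()) - A j (sepF A l j) else 1) - s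

lemma Rf_mem {q h : ℕ} [NeZero q] (A : Fin q → Fin q → ℝ) (lam : Fin q → Fin h × Bool)
    (hl : Function.Injective lam) (l : Fin q) (s : ℝ) :
    Rf A lam l s ∈ MLs {e | ∃ m, e = s(Sum.inl m, Sum.inr ())} := by
  have h1 := MLs_pins (fun j : Fin q => j ≠ l)
    (fun j => (s(Sum.inl (lam j, sepF A l j), Sum.inr ()) : Sym2 (MT q h ⊕ Unit)))
    (fun j => A j (sepF A l j)) (by
      intro i j _ _ H
      simp only [Sym2.eq_iff, Sum.inl.injEq, Prod.mk.injEq] at H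
      rcases H with ⟨⟨h1, _⟩, _⟩ | ⟨h1, _⟩
      · exact hl h1
      · cases h1)
  have h2 := (MLs _).sub_mem ((MLs _).smul_mem (kap A l)⁻¹ h1) (MLs_const _ s)
  refine MLs_mono ?_ h2
  rintro _ ⟨j, _, rfl⟩
  exact ⟨_, rfl⟩

lemma kap_ne {q : ℕ} [NeZero q] (A : Fin q → Fin q → ℝ)
    (htw : ∀ l j, l ≠ j → ∃ i, A l i ≠ A j i) (l : Fin q) : kap A l ≠ 0 := by
  unfold kap
  rw [Finset.prod_ne_zero_iff]
  intro j _
  split_ifs with h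
  · exact sub_ne_zero.2 (sepF_spec A htw l j (Ne.symm h))
  · exact one_ne_zero

lemma RS_eval {q h : ℕ} [NeZero q] (A : Fin q → Fin q → ℝ)
    (htw : ∀ l j, l ≠ j → ∃ i, A l i ≠ A j i) (lam : Fin q → Fin h × Bool)
    (β : Fin q → ℝ) (hβ : ∑ i, β i = 1) (B : Fin q → Fin q → ℝ) (hB : ∀ i j, B i j = B j i)
    (f : MT q h → Fin q) (σ : Equiv.Perm (Fin q)) (hf : ∀ L l, f (L, l) = σ l)
    (hBA : ∀ i j, B (σ i) (σ j) = A i j) (l : Fin q) (s : ℝ) :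
    RS β B hB (Rf A lam l s) f = β (σ l) - s := by
  unfold RS
  rw [← Equiv.sum_comp σ]
  have : ∀ z, β (σ z) * Rf A lam l s (ev B hB (Sum.elim f (fun _ => σ z)))
      = (if z = l then β (σ z) else 0) - β (σ z) * s := by
    intro z
    unfold Rf
    simp only [ev_mk, Sum.elim_inl, Sum.elim_inr, hf, hB _ (σ z), hBA]
    by_cases hz : z = l
    · subst hz
      rw [if_pos rfl]
      change β (σ z) * ((kap A z)⁻¹ * (kap A z) - s) = _
      rw [inv_mul_cancel₀ (kap_ne A htw z)]
      ring
    · rw [if_neg hz, Finset.prod_eq_zero (Finset.mem_univ z)]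
      · ring
      · rw [if_pos hz, sub_self]
  rw [Finset.sum_congr rfl (fun z _ => this z), Finset.sum_sub_distrib, ← Finset.sum_mul,
    Equiv.sum_comp σ β, hβ]
  simp

lemma sum_mul_const {F : Type} [Fintype F] (x g : F → ℝ) (c : ℝ) (h : ∀ f, x f ≠ 0 → g f = c) :
    ∑ f, x f * g f = (∑ f, x f) * c := by
  rw [Finset.sum_mul]
  refine Finset.sum_congr rfl fun f _ => ?_
  by_cases hx : x f = 0
  · simp [hx]
  · rw [h f hx]

lemma P1f_eval {q h : ℕ} [NeZero h] (t : ℝ) (B : Fin q → Fin q → ℝ) (hB : ∀ i j, B i j = B j i)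
    (f : MT q h → Fin q) (σ : Equiv.Perm (Fin q)) (hf : ∀ L l, f (L, l) = σ l) :
    P1f t (ev B hB f) = ∏ p : Pr q, (B p.1.1 p.1.2 - t) := by
  unfold P1f
  simp only [ev_mk, hf, if_true]
  exact prod_Pr_perm (fun i j => B i j - t) (fun i j => by rw [hB]) σ

lemma P2f_eval {q h : ℕ} [NeZero h] (t : ℝ) (B : Fin q → Fin q → ℝ) (hB : ∀ i j, B i j = B j i)
    (f : MT q h → Fin q) (σ : Equiv.Perm (Fin q)) (hf : ∀ L l, f (L, l) = σ l) :
    P2f t (ev B hB f) = ∏ i : Fin q, (B i i - t) := by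
  unfold P2f
  simp only [ev_mk, hf, if_true]
  exact Equiv.prod_comp σ (fun i => B i i - t)

lemma PP_eval {q h : ℕ} (A : Fin q → Fin q → ℝ) (lam : Fin q → Fin h × Bool)
    (B : Fin q → Fin q → ℝ) (hB : ∀ i j, B i j = B j i)
    (f : MT q h → Fin q) (σ : Equiv.Perm (Fin q)) (hf : ∀ L l, f (L, l) = σ l) :
    PPa A lam (ev B hB f) * PPb A lam (ev B hB f) =
      Pin (fun p : Pr q => A p.1.1 p.1.2) (fun p : Pr q => B (σ p.1.1) (σ p.1.2)) *
      Pin (fun i : Fin q => A i i) (fun i : Fin q => B (σ i) (σ i)) := by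
  unfold PPa PPb Pin
  rw [Fintype.prod_prod_type, Fintype.prod_prod_type]
  simp only [ev_mk, hf]

lemma PP_ne {q h : ℕ} (A : Fin q → Fin q → ℝ) (hA : ∀ i j, A i j = A j i) (lam : Fin q → Fin h × Bool)
    (B : Fin q → Fin q → ℝ) (hB : ∀ i j, B i j = B j i)
    (h1 : ∀ t, ∏ p : Pr q, (A p.1.1 p.1.2 - t) = ∏ p : Pr q, (B p.1.1 p.1.2 - t))
    (h2 : ∀ t, ∏ i, (A i i - t) = ∏ i, (B i i - t))
    (f : MT q h → Fin q) (σ : Equiv.Perm (Fin q)) (hf : ∀ L l, f (L, l) = σ l)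
    (hne : PPa A lam (ev B hB f) * PPb A lam (ev B hB f) ≠ 0) :
    ∀ i j, B (σ i) (σ j) = A i j := by
  rw [PP_eval A lam B hB f σ hf] at hne
  obtain ⟨ha, hb⟩ := multi_eq2 (fun p : Pr q => A p.1.1 p.1.2)
    (fun p : Pr q => B (σ p.1.1) (σ p.1.2)) (by
      intro t
      rw [h1 t, ← prod_Pr_perm (fun i j => B i j - t) (fun i j => by rw [hB]) σ])
  obtain ⟨hc, hd⟩ := multi_eq2 (fun i : Fin q => A i i)
    (fun i : Fin q => B (σ i) (σ i)) (by
      intro t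
      rw [h2 t]; exact (Equiv.prod_comp σ (fun i => B i i - t)).symm)
  have e1 := Pin_eq _ _ ha hb (left_ne_zero_of_mul hne)
  have e2 := Pin_eq _ _ hc hd (right_ne_zero_of_mul hne)
  intro i j
  rcases lt_trichotomy i j with hij | rfl | hij
  · exact congrFun e1 ⟨(i, j), hij⟩
  · exact congrFun e2 i
  · rw [hB, hA]; exact congrFun e1 ⟨(j, i), hij⟩

lemma exists_lam (q : ℕ) : ∃ lam : Fin q → Fin ((q + 1) / 2) × Bool, Function.Injective lam := by
  refine ⟨fun i => (⟨i.1 / 2, by omega⟩, decide (i.1 % 2 = 1)), ?_⟩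
  intro i j H
  simp only [Prod.mk.injEq, Fin.mk.injEq, decide_eq_decide] at H
  apply Fin.ext
  omega

lemma card_lt_pairs {q : ℕ} (α : Fin q → ℝ) :
    2 * Fintype.card {p : Fin q × Fin q // α p.2 < α p.1} + q ≤ q * q := by
  let X := {p : Fin q × Fin q // α p.2 < α p.1}
  let F : (X ⊕ X) ⊕ Fin q → Fin q × Fin q :=
    Sum.elim (Sum.elim (fun p => p.1) (fun p => (p.1.2, p.1.1))) (fun i => (i, i))
  have hF : Function.Injective F := by
    rintro ((⟨⟨i, j⟩, h⟩ | ⟨⟨i, j⟩, h⟩) | i) ((⟨⟨i', j'⟩, h'⟩ | ⟨⟨i', j'⟩, h'⟩) | i') H <;>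
      simp only [F, Sum.elim_inl, Sum.elim_inr, Prod.mk.injEq] at H <;> obtain ⟨h1, h2⟩ := H <;>
      (try simp only at h) <;> (try simp only at h') <;> subst h1 <;> (try subst h2) <;> first
      | rfl
      | (exfalso; exact absurd h (not_lt.2 h'.le))
      | (exfalso; exact absurd h (lt_irrefl _))
      | (exfalso; exact absurd h' (lt_irrefl _))
  have := Fintype.card_le_of_injective F hF
  simp only [Fintype.card_sum, Fintype.card_prod, Fintype.card_fin] at this
  change 2 * Fintype.card X + q ≤ q * q
  omega

theorem finite_main {q k : ℕ} (hq : 2 ≤ q) (hk : k ≤ q) (α : Fin q → ℝ) (A : Fin q → Fin q → ℝ)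
    (hA : ∀ i j, A i j = A j i) (hα : ∀ i, 0 < α i) (hαs : ∑ i, α i = 1)
    (htw : ∀ l j, l ≠ j → ∃ i, A l i ≠ A j i)
    (β : Fin k → ℝ) (B : Fin k → Fin k → ℝ) (hB : ∀ i j, B i j = B j i) (hβs : ∑ i, β i = 1)
    (hag : ∀ (V : Type) [Fintype V], Fintype.card V ≤ 4 * q ^ 2 - q →
      ∀ f : (Sym2 V → ℝ) → ℝ, f ∈ MLs {e | ¬ e.IsDiag} → fsum V α A hA f = fsum V β B hB f) :
    ∃ σ : Fin q ≃ Fin k, (∀ i, β (σ i) = α i) ∧ ∀ i j, B (σ i) (σ j) = A i j := by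
  have : NeZero q := ⟨by omega⟩
  have : NeZero ((q + 1) / 2) := ⟨by omega⟩
  obtain ⟨lam, hlam⟩ := exists_lam q
  generalize hh : (q + 1) / 2 = h at *
  have hcard : Fintype.card (MT q h ⊕ WT q) = 2 * h * q + 2 * (q * q) := by
    simp only [Fintype.card_sum, Fintype.card_prod, Fintype.card_fin, Fintype.card_bool]; ring
  have hsz : ∀ c, (2 * c + q ≤ q * q ∨ c = q ∨ c = 0) → 2 * h * q + 2 * (q * q) + c ≤ 4 * q ^ 2 - q := by
    intro c hc
    have h1 : 2 * h ≤ q + 1 := by omega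
    rcases Nat.lt_or_ge q 3 with h3 | h3
    · obtain rfl : q = 2 := by omega
      obtain rfl : h = 1 := by omega
      omega
    · have h2 : 2 * h * q ≤ (q + 1) * q := Nat.mul_le_mul_right _ h1
      have h4 : 3 * q ≤ q * q := Nat.mul_le_mul_right _ h3
      have h5 : (q + 1) * q = q * q + q := by ring
      rw [pow_two]
      omega
  have master : ∀ (X : Type) [Fintype X] (P : (Sym2 (MT q h) → ℝ) → ℝ)
      (R : X → (Sym2 (MT q h ⊕ Unit) → ℝ) → ℝ), P ∈ MLs {e | ¬ e.IsDiag} →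
      (∀ x, R x ∈ MLs {e | ∃ m, e = s(Sum.inl m, Sum.inr ())}) →
      (2 * Fintype.card X + q ≤ q * q ∨ Fintype.card X = q ∨ Fintype.card X = 0) →
      ∑ f : MT q h → Fin q, XX α A hA (TT A) f * P (ev A hA f) * ∏ x, RS α A hA (R x) f =
      ∑ f : MT q h → Fin k, XX β B hB (TT A) f * P (ev B hB f) * ∏ x, RS β B hB (R x) f := by
    intro X _ P R hP hR hc
    have h1 := hag ((MT q h ⊕ WT q) ⊕ X) (by
      rw [Fintype.card_sum, hcard]
      exact hsz _ hc) (MF (TT A) P R) (MF_mem _ _ _ (TT_mem A) hP hR)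
    rw [fsum_MF, fsum_MF] at h1
    convert h1
  have master0 : ∀ P : (Sym2 (MT q h) → ℝ) → ℝ, P ∈ MLs {e | ¬ e.IsDiag} →
      ∑ f : MT q h → Fin q, XX α A hA (TT A) f * P (ev A hA f) =
      ∑ f : MT q h → Fin k, XX β B hB (TT A) f * P (ev B hB f) := by
    intro P hP
    have := master Empty P (fun x => x.elim) hP (fun x => x.elim) (by simp)
    simpa using this
  have hX0 : ∀ f : MT q h → Fin q, 0 ≤ XX α A hA (TT A) f := XX_nonneg α hα A hA
  have hXp := XX_pos (h := h) α hα A hA htw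
  have hKpos : 0 < ∑ f : MT q h → Fin q, XX α A hA (TT A) f :=
    Finset.sum_pos' (fun f _ => hX0 f) ⟨_, Finset.mem_univ _, hXp⟩
  have hK := master0 (fun _ => 1) (MLs_const _ 1)
  simp only [mul_one] at hK
  have hkq : k = q := by
    rw [hK] at hKpos
    obtain ⟨f, _, hf⟩ := Finset.exists_ne_zero_of_sum_ne_zero hKpos.ne'
    obtain ⟨σ, hσ, _⟩ := XX_ne A β B hB hk f hf
    simpa using (Fintype.card_of_bijective hσ).symm
  subst hkq
  have hXne : ∀ (β : Fin k → ℝ) (B : Fin k → Fin k → ℝ)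
    (hB : ∀ i j, B i j = B j i) (f : MT k h → Fin k), XX β B hB (TT A) f ≠ 0 →
      ∃ σ : Equiv.Perm (Fin k), ∀ L l, f (L, l) = σ l := by
    intro β B hB f hf
    obtain ⟨σ, hσ, h2⟩ := XX_ne A β B hB le_rfl f hf
    exact ⟨Equiv.ofBijective σ hσ, h2⟩
  have hoff : ∀ t, ∏ p : Pr k, (A p.1.1 p.1.2 - t) = ∏ p : Pr k, (B p.1.1 p.1.2 - t) := by
    intro t
    have := master0 (P1f t) (P1f_mem t)
    rw [sum_mul_const _ _ (∏ p : Pr k, (A p.1.1 p.1.2 - t)), 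
      sum_mul_const _ _ (∏ p : Pr k, (B p.1.1 p.1.2 - t)), ← hK] at this
    · exact mul_left_cancel₀ hKpos.ne' this
    · intro f hf
      obtain ⟨σ, hσ⟩ := hXne _ _ _ f hf
      exact P1f_eval t B hB f σ hσ
    · intro f hf
      obtain ⟨σ, hσ⟩ := hXne _ _ _ f hf
      exact P1f_eval t A hA f σ hσ
  have hdiag : ∀ t, ∏ i, (A i i - t) = ∏ i, (B i i - t) := by
    intro t
    have := master0 (P2f t) (P2f_mem t)
    rw [sum_mul_const _ _ (∏ i, (A i i - t)), 
      sum_mul_const _ _ (∏ i, (B i i - t)), ← hK] at this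
    · exact mul_left_cancel₀ hKpos.ne' this
    · intro f hf
      obtain ⟨σ, hσ⟩ := hXne _ _ _ f hf
      exact P2f_eval t B hB f σ hσ
    · intro f hf
      obtain ⟨σ, hσ⟩ := hXne _ _ _ f hf
      exact P2f_eval t A hA f σ hσ
  have hPP := PP_mem A lam hlam
  set PP : (Sym2 (MT k h) → ℝ) → ℝ := fun v => PPa A lam v * PPb A lam v with hPPdef
  have hPPpos : ∀ f (σ : Equiv.Perm (Fin k)), (∀ L l, f (L, l) = σ l) → (∀ i j, A (σ i) (σ j) = A i j) →
      0 < PP (ev A hA f) := by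
    intro f σ hf hσ
    have := PP_eval A lam A hA f σ hf
    simp only [hPPdef]
    rw [this]
    simp only [hσ]
    exact mul_pos (Pin_pos _) (Pin_pos _)
  have hYA : ∀ f, XX α A hA (TT A) f * PP (ev A hA f) ≠ 0 →
      ∃ σ : Equiv.Perm (Fin k), (∀ L l, f (L, l) = σ l) ∧ ∀ i j, A (σ i) (σ j) = A i j := by
    intro f hf
    obtain ⟨σ, hσ⟩ := hXne _ _ _ f (left_ne_zero_of_mul hf)
    exact ⟨σ, hσ, PP_ne A hA lam A hA (fun _ => rfl) (fun _ => rfl) f σ hσ (right_ne_zero_of_mul hf)⟩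
  have hYB : ∀ f, XX β B hB (TT A) f * PP (ev B hB f) ≠ 0 →
      ∃ σ : Equiv.Perm (Fin k), (∀ L l, f (L, l) = σ l) ∧ ∀ i j, B (σ i) (σ j) = A i j := by
    intro f hf
    obtain ⟨σ, hσ⟩ := hXne _ _ _ f (left_ne_zero_of_mul hf)
    exact ⟨σ, hσ, PP_ne A hA lam B hB hoff hdiag f σ hσ (right_ne_zero_of_mul hf)⟩
  have hY0 : ∀ f, 0 ≤ XX α A hA (TT A) f * PP (ev A hA f) := by
    intro f
    by_contra hlt
    obtain ⟨σ, h1, h2⟩ := hYA f (fun H => hlt H.ge)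
    exact hlt (mul_nonneg (hX0 f) (hPPpos f σ h1 h2).le)
  have hYp : 0 < XX α A hA (TT A) (fun m : MT k h => m.2) * PP (ev A hA (fun m : MT k h => m.2)) :=
    mul_pos hXp (hPPpos _ (Equiv.refl _) (fun _ _ => rfl) (fun _ _ => rfl))
  have hC := master0 PP hPP
  have hCpos : 0 < ∑ f : MT k h → Fin k, XX α A hA (TT A) f * PP (ev A hA f) :=
    Finset.sum_pos' (fun f _ => hY0 f) ⟨_, Finset.mem_univ _, hYp⟩
  have hw : ∀ t, ∏ i, (α i - t) = ∏ i, (β i - t) := by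
    intro t
    have := master (Fin k) PP (fun l => Rf A lam l t) hPP (fun l => Rf_mem A lam hlam l t) (by simp)
    rw [sum_mul_const (fun f => XX α A hA (TT A) f * PP (ev A hA f)) _ (∏ i, (α i - t)),
      sum_mul_const (fun f => XX β B hB (TT A) f * PP (ev B hB f)) _ (∏ i, (β i - t)),
      ← hC] at this
    · exact mul_left_cancel₀ hCpos.ne' this
    · intro f hf
      obtain ⟨σ, h1, h2⟩ := hYB f hf
      simp only [RS_eval A htw lam β hβs B hB f σ h1 h2]
      exact Equiv.prod_comp σ (fun i => β i - t)
    · intro f hf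
      obtain ⟨σ, h1, h2⟩ := hYA f hf
      simp only [RS_eval A htw lam α hαs A hA f σ h1 h2]
      exact Equiv.prod_comp σ (fun i => α i - t)
  have pinX : ∀ x : Fin k → ℝ, ∏ p : {p : Fin k × Fin k // α p.2 < α p.1}, (x p.1.1 - α p.1.2)
      = Pin α x := by
    intro x
    unfold Pin
    rw [← Fintype.prod_prod_type' (fun j i => if α i < α j then x j - α i else 1),
      ← Finset.prod_filter]
    exact (Finset.prod_subtype _ (by simp) (fun p : Fin k × Fin k => x p.1 - α p.2)).symm
  have hfin := master {p : Fin k × Fin k // α p.2 < α p.1} PP (fun p => Rf A lam p.1.1 (α p.1.2)) hPP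
    (fun l => Rf_mem A lam hlam _ _) (Or.inl (card_lt_pairs α))
  have hRA : ∀ f (σ : Equiv.Perm (Fin k)), (∀ L l, f (L, l) = σ l) → (∀ i j, A (σ i) (σ j) = A i j) →
      ∏ p : {p : Fin k × Fin k // α p.2 < α p.1}, RS α A hA (Rf A lam p.1.1 (α p.1.2)) f
       = Pin α (fun i => α (σ i)) := by
    intro f σ h1 h2
    simp only [RS_eval A htw lam α hαs A hA f σ h1 h2]
    exact pinX (fun i => α (σ i))
  have hRB : ∀ f (σ : Equiv.Perm (Fin k)), (∀ L l, f (L, l) = σ l) → (∀ i j, B (σ i) (σ j) = A i j) →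
      ∏ p : {p : Fin k × Fin k // α p.2 < α p.1}, RS β B hB (Rf A lam p.1.1 (α p.1.2)) f
       = Pin α (fun i => β (σ i)) := by
    intro f σ h1 h2
    simp only [RS_eval A htw lam β hβs B hB f σ h1 h2]
    exact pinX (fun i => β (σ i))
  have hLpos : 0 < ∑ f : MT k h → Fin k, XX α A hA (TT A) f * PP (ev A hA f) *
      ∏ p : {p : Fin k × Fin k // α p.2 < α p.1}, RS α A hA (Rf A lam p.1.1 (α p.1.2)) f := by
    refine Finset.sum_pos' (fun f _ => ?_) ⟨_, Finset.mem_univ (fun m : MT k h => m.2), ?_⟩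
    · by_contra hlt
      have hne : XX α A hA (TT A) f * PP (ev A hA f) *
        ∏ p : {p : Fin k × Fin k // α p.2 < α p.1}, RS α A hA (Rf A lam p.1.1 (α p.1.2)) f ≠ 0 :=
        fun H => hlt H.ge
      obtain ⟨σ, h1, h2⟩ := hYA f (left_ne_zero_of_mul hne)
      apply hlt
      have h3 := right_ne_zero_of_mul hne
      rw [hRA f σ h1 h2] at h3 ⊢
      have h4 := Pin_eq α _ (fun j => ⟨σ j, rfl⟩) (Equiv.sum_comp σ α) h3
      rw [h4]
      exact mul_nonneg (hY0 f) (Pin_pos α).le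
    · refine mul_pos hYp ?_
      rw [hRA _ (Equiv.refl _) (fun _ _ => rfl) (fun _ _ => rfl)]
      exact Pin_pos α
  rw [hfin] at hLpos
  obtain ⟨f, _, hf⟩ := Finset.exists_ne_zero_of_sum_ne_zero hLpos.ne'
  obtain ⟨σ, h1, h2⟩ := hYB f (left_ne_zero_of_mul hf)
  have h3 := right_ne_zero_of_mul hf
  rw [hRB f σ h1 h2] at h3
  obtain ⟨ha, _⟩ := multi_eq2 α β hw
  have h4 := Pin_eq α _ (fun j => ha (σ j))
    ((Equiv.sum_comp σ β).trans (hβs.trans hαs.symm)) h3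
  exact ⟨σ, fun i => congrFun h4 i, h2⟩

lemma ev_measurable {V : Type} [Fintype V] (U : GKernel) (e : Sym2 V) :
    Measurable (fun x : V → I01 => ev U.toFun U.symm' x e) := by
  induction e using Sym2.ind with
  | _ u v =>
    simp only [ev_mk]
    have h : Measurable (fun x : V → I01 => (x u, x v)) :=
      (measurable_pi_apply u).prodMk (measurable_pi_apply v)
    exact U.measurable'.comp h

lemma ev_bounded {V : Type} (U : GKernel) : ∃ C : ℝ, ∀ (x : V → I01) (e : Sym2 V),
    |ev U.toFun U.symm' x e| ≤ C := by
  obtain ⟨C, hC⟩ := U.bounded'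
  refine ⟨C, fun x e => ?_⟩
  induction e using Sym2.ind with
  | _ u v => exact hC _ _

lemma MLs_integrable {V : Type} [Fintype V] (U : GKernel) (E : Set (Sym2 V))
    (f : (Sym2 V → ℝ) → ℝ) (hf : f ∈ MLs E) :
    Integrable (fun x : V → I01 => f (ev U.toFun U.symm' x)) := by
  induction hf using Submodule.span_induction with
  | mem f hf =>
    obtain ⟨S, hS, rfl⟩ := hf
    obtain ⟨C, hC⟩ := ev_bounded (V := V) U
    refine Integrable.of_bound (C := ∏ e ∈ S, C) ?_ ?_
    · exact (Finset.measurable_prod S (fun e _ => ev_measurable U e)).aestronglyMeasurable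
    · refine Filter.Eventually.of_forall fun x => ?_
      rw [Real.norm_eq_abs, Finset.abs_prod]
      exact Finset.prod_le_prod (fun _ _ => abs_nonneg _) (fun e _ => hC x e)
  | zero => exact integrable_zero _ _ _
  | add f g _ _ hf hg => exact hf.add hg
  | smul c f _ hf => exact hf.smul c

lemma MLs_agree (N : ℕ) (W W' : GKernel)
    (hagree : ∀ n : ℕ, n ≤ N → ∀ H : SimpleGraph (Fin n), homDensity H W' = homDensity H W)
    (V : Type) [Fintype V] (hV : Fintype.card V ≤ N) (f : (Sym2 V → ℝ) → ℝ)
    (hf : f ∈ MLs {e | ¬ e.IsDiag}) :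
    ∫ x : V → I01, f (ev W'.toFun W'.symm' x) = ∫ x : V → I01, f (ev W.toFun W.symm' x) := by
  induction hf using Submodule.span_induction with
  | mem f hf =>
    obtain ⟨S, hS, rfl⟩ := hf
    exact mdens_agree N W W' hagree V hV S (fun e he => hS he)
  | zero => simp
  | add f g hf hg ihf ihg =>
    simp only [Pi.add_apply]
    rw [integral_add (MLs_integrable W' _ f hf) (MLs_integrable W' _ g hg),
      integral_add (MLs_integrable W _ f hf) (MLs_integrable W _ g hg), ihf, ihg]
  | smul c f hf ih =>
    simp only [Pi.smul_apply]
    rw [integral_smul, integral_smul, ih]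

lemma pair_mp {V : Type} [Fintype V] (u v : V) (huv : u ≠ v) :
    MeasurePreserving (fun x : V → I01 => (x u, x v)) volume volume := by
  refine ⟨(measurable_pi_apply u).prodMk (measurable_pi_apply v), ?_⟩
  have hi := ProbabilityTheory.iIndepFun_pi (ι := V) (Ω := fun _ => I01)
    (μ := fun _ : V => (volume : Measure I01))
    (X := fun (_ : V) (x : I01) => x) (fun _ => aemeasurable_id)
  have h2 := hi.indepFun huv
  rw [ProbabilityTheory.indepFun_iff_map_prod_eq_prod_map_map
    (measurable_pi_apply u).aemeasurable (measurable_pi_apply v).aemeasurable] at h2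
  have e := fun w : V => (measurePreserving_eval (fun _ : V => (volume : Measure I01)) w).map_eq
  have e' : ∀ w : V, Measure.map (fun ω : V → I01 => ω w) (Measure.pi fun _ => volume) = volume := e
  rw [e', e'] at h2
  exact h2

def IsRep (U : GKernel) {k : ℕ} (p : I01 → Fin k) (M : Fin k → Fin k → ℝ) : Prop :=
  ∀ᵐ z : I01 × I01, U.toFun z.1 z.2 = M (p z.1) (p z.2)

lemma rep_mdens (U : GKernel) {k : ℕ} (p : I01 → Fin k) (hp : Measurable p)
    (M : Fin k → Fin k → ℝ) (hM : ∀ i j, M i j = M j i) (hU : IsRep U p M)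
    (V : Type) [Fintype V] (S : Finset (Sym2 V)) (hS : ∀ e ∈ S, ¬ e.IsDiag) :
    mdens V U S = fsum V (fun i => volume.real (p ⁻¹' {i})) M hM (fun v => ∏ e ∈ S, v e) := by
  have hae : ∀ᵐ x : V → I01, ∀ e ∈ S, ev U.toFun U.symm' x e = ev M hM (fun v => p (x v)) e := by
    rw [Filter.eventually_all_finset]
    intro e he
    have := hS e he
    induction e using Sym2.ind with
    | _ u v =>
      rw [Sym2.mk_isDiag_iff] at this
      exact (pair_mp u v this).quasiMeasurePreserving.ae hU
  unfold mdens
  have h1 : ∫ x : V → I01, ∏ e ∈ S, ev U.toFun U.symm' x e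
      = ∫ x : V → I01, (fun φ : V → Fin k => ∏ e ∈ S, ev M hM φ e) (fun v => p (x v)) := by
    apply integral_congr_ae
    filter_upwards [hae] with x hx
    exact Finset.prod_congr rfl hx
  rw [h1]
  have hmeas : Measurable (fun x : V → I01 => (fun v => p (x v))) :=
    measurable_pi_lambda _ fun v => hp.comp (measurable_pi_apply v)
  rw [← integral_map (f := fun φ : V → Fin k => ∏ e ∈ S, ev M hM φ e) hmeas.aemeasurable
    (Measurable.aestronglyMeasurable (measurable_of_finite _))]
  have h2 : Measure.map (fun x : V → I01 => (fun v => p (x v))) volume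
      = Measure.pi (fun _ : V => Measure.map p volume) :=
    Measure.pi_map_pi (f := fun _ => p) (μ := fun _ : V => (volume : Measure I01))
      (fun _ => hp.aemeasurable)
  rw [h2]
  have : IsProbabilityMeasure (Measure.map p (volume : Measure I01)) :=
    Measure.isProbabilityMeasure_map hp.aemeasurable
  rw [integral_fintype (Integrable.of_finite)]
  unfold fsum
  refine Finset.sum_congr (by congr!) fun φ _ => ?_
  rw [smul_eq_mul]
  congr 1
  rw [Measure.real, Measure.pi_singleton, ENNReal.toReal_prod]
  refine Finset.prod_congr rfl fun v _ => ?_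
  rw [Measure.map_apply hp (measurableSet_singleton _)]
  rfl

lemma rep_sum {k : ℕ} (p : I01 → Fin k) (hp : Measurable p) :
    ∑ i, (volume : Measure I01).real (p ⁻¹' {i}) = 1 := by
  have h := measureReal_biUnion_finset (μ := (volume : Measure I01)) (s := Finset.univ)
    (f := fun i : Fin k => p ⁻¹' {i}) (by
      intro i _ j _ hij
      exact Disjoint.preimage _ (by simpa using hij)) (fun i _ => hp (measurableSet_singleton _))
  rw [← h]
  have : (⋃ b ∈ (Finset.univ : Finset (Fin k)), p ⁻¹' {b}) = Set.univ := by
    ext x; simp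
  rw [this]
  simp

/-- bounded measurable -/
def BM {α : Type} [MeasurableSpace α] (f : α → ℝ) : Prop := Measurable f ∧ ∃ C : ℝ, ∀ x, |f x| ≤ C

lemma BM.integrable {α : Type} [MeasurableSpace α] {μ : Measure α} [IsFiniteMeasure μ] {f : α → ℝ}
    (h : BM f) : Integrable f μ := by
  obtain ⟨hm, C, hC⟩ := h
  exact Integrable.of_bound hm.aestronglyMeasurable C (Filter.Eventually.of_forall hC)

lemma BM.mul {α : Type} [MeasurableSpace α] {f g : α → ℝ} (hf : BM f) (hg : BM g) :
    BM (fun x => f x * g x) := by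
  obtain ⟨hm, C, hC⟩ := hf
  obtain ⟨hm', C', hC'⟩ := hg
  refine ⟨hm.mul hm', C * C', fun x => ?_⟩
  rw [abs_mul]
  exact mul_le_mul (hC x) (hC' x) (abs_nonneg _) ((abs_nonneg _).trans (hC x))

lemma BM.sub {α : Type} [MeasurableSpace α] {f g : α → ℝ} (hf : BM f) (hg : BM g) :
    BM (fun x => f x - g x) := by
  obtain ⟨hm, C, hC⟩ := hf
  obtain ⟨hm', C', hC'⟩ := hg
  refine ⟨hm.sub hm', C + C', fun x => ?_⟩
  exact (abs_sub _ _).trans (add_le_add (hC x) (hC' x))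

lemma BM.comp {α β : Type} [MeasurableSpace α] [MeasurableSpace β] {f : α → ℝ} (hf : BM f)
    {g : β → α} (hg : Measurable g) : BM (fun x => f (g x)) :=
  ⟨hf.1.comp hg, hf.2.imp fun _ h x => h (g x)⟩

lemma BM.integral {α β : Type} [MeasurableSpace α] [MeasurableSpace β] {μ : Measure β}
    [IsProbabilityMeasure μ] {f : α → β → ℝ} (hf : BM (fun z : α × β => f z.1 z.2)) :
    BM (fun x => ∫ y, f x y ∂μ) := by
  obtain ⟨hm, C, hC⟩ := hf
  refine ⟨?_, C, fun x => ?_⟩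
  · exact (StronglyMeasurable.integral_prod_right (f := f) hm.stronglyMeasurable).measurable
  · have := norm_integral_le_of_norm_le_const (μ := μ) (f := fun y => f x y) (C := C)
      (Filter.Eventually.of_forall fun y => hC (x, y))
    simpa using this

lemma BM_fin {α : Type} [MeasurableSpace α] {k : ℕ} {p : α → Fin k} (hp : Measurable p)
    (c : Fin k → ℝ) : BM (fun x => c (p x)) := by
  refine ⟨(measurable_of_finite c).comp hp, ∑ i, |c i|, fun x => ?_⟩
  exact Finset.single_le_sum (f := fun i => |c i|) (fun i _ => abs_nonneg _) (Finset.mem_univ (p x))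

lemma BM_K (U : GKernel) : BM (fun z : I01 × I01 => U.toFun z.1 z.2) :=
  ⟨U.measurable', U.bounded'.imp fun _ h z => h z.1 z.2⟩

def CC (U : GKernel) (x y : I01) : ℝ := ∫ w, U.toFun x w * U.toFun w y

lemma BM_CC (U : GKernel) : BM (fun z : I01 × I01 => CC U z.1 z.2) := by
  unfold CC
  apply BM.integral (f := fun (z : I01 × I01) w => U.toFun z.1 w * U.toFun w z.2)
  exact ((BM_K U).comp (g := fun t : (I01 × I01) × I01 => (t.1.1, t.2)) (by fun_prop)).mul
    ((BM_K U).comp (g := fun t : (I01 × I01) × I01 => (t.2, t.1.2)) (by fun_prop))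

def dd (U : GKernel) (x x' : I01) : ℝ := ∫ y, (CC U x y - CC U x' y) ^ 2

lemma BM_dd (U : GKernel) : BM (fun z : I01 × I01 => dd U z.1 z.2) := by
  unfold dd
  apply BM.integral (f := fun (z : I01 × I01) y => (CC U z.1 y - CC U z.2 y) ^ 2)
  have h := ((BM_CC U).comp (g := fun t : (I01 × I01) × I01 => (t.1.1, t.2)) (by fun_prop)).sub
    ((BM_CC U).comp (g := fun t : (I01 × I01) × I01 => (t.1.2, t.2)) (by fun_prop))
  have h2 := h.mul h
  simp only [← pow_two] at h2
  exact h2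

lemma dd_zero (U : GKernel) (x x' : I01) (h : dd U x x' = 0) : ∀ᵐ y, CC U x y = CC U x' y := by
  unfold dd at h
  have hb : BM (fun y => CC U x y - CC U x' y) :=
    ((BM_CC U).comp (g := fun t : I01 => (x, t)) (by fun_prop)).sub
    ((BM_CC U).comp (g := fun t : I01 => (x', t)) (by fun_prop))
  have h2 := hb.mul hb
  simp only [← pow_two] at h2
  rw [integral_eq_zero_iff_of_nonneg (fun y => sq_nonneg _) h2.integrable] at h
  filter_upwards [h] with y hy
  have := pow_eq_zero_iff (two_ne_zero) |>.1 hy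
  linarith

lemma class_int {k : ℕ} {p : I01 → Fin k} (hp : Measurable p) {f : I01 → ℝ} (hf : BM f)
    (c : Fin k → ℝ) :
    ∫ y, f y * c (p y) = ∑ i, c i * ∫ y, (if p y = i then f y else 0) := by
  have h1 : ∀ i, BM (fun y => (if p y = i then f y else 0)) := by
    intro i
    have := hf.mul (BM_fin hp (fun j => if j = i then (1 : ℝ) else 0))
    simpa using this
  simp only [← integral_const_mul]
  rw [← integral_finset_sum]
  · congr 1
    funext y
    simp [mul_comm]
  · intro i _
    exact (h1 i).integrable.const_mul _

/-- T f = 0 when f has zero class integrals -/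
lemma T_zero (U : GKernel) {k : ℕ} {p : I01 → Fin k} (hp : Measurable p) (pts : Fin k → I01)
    (hae : ∀ᵐ y, ∀ᵐ z, CC U y z = CC U (pts (p y)) z) {f : I01 → ℝ} (hf : BM f)
    (h0 : ∀ i, ∫ y, (if p y = i then f y else 0) = 0) :
    ∀ᵐ w, ∫ y, U.toFun w y * f y = 0 := by
  have hTb : BM (fun w => ∫ y, U.toFun w y * f y) := by
    apply BM.integral (f := fun w y => U.toFun w y * f y)
    exact (BM_K U).mul (hf.comp measurable_snd)
  have hTT := hTb.mul hTb
  have key : ∫ w, (∫ y, U.toFun w y * f y) * (∫ y, U.toFun w y * f y) = 0 := by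
    have e1 : ∀ w, (∫ y, U.toFun w y * f y) * (∫ y, U.toFun w y * f y)
        = ∫ z : I01 × I01, (U.toFun w z.1 * f z.1) * (U.toFun w z.2 * f z.2) := by
      intro w
      exact (integral_prod_mul (fun y => U.toFun w y * f y) (fun y => U.toFun w y * f y)).symm
    simp only [e1]
    rw [integral_integral_swap]
    · have e2 : ∀ z : I01 × I01, ∫ w, (U.toFun w z.1 * f z.1) * (U.toFun w z.2 * f z.2)
          = f z.1 * f z.2 * CC U z.1 z.2 := by
        intro z
        unfold CC
        rw [← integral_const_mul]
        congr 1
        funext w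
        rw [U.symm' w z.1]
        ring
      simp only [e2]
      have e3 : ∫ z : I01 × I01, f z.1 * f z.2 * CC U z.1 z.2
          = ∫ z : I01 × I01, f z.1 * f z.2 * CC U (pts (p z.1)) z.2 := by
        have m1 : BM (fun z : I01 × I01 => f z.1 * f z.2 * CC U z.1 z.2) :=
          ((hf.comp measurable_fst).mul (hf.comp measurable_snd)).mul (BM_CC U)
        have m2 : BM (fun z : I01 × I01 => f z.1 * f z.2 * CC U (pts (p z.1)) z.2) :=
          ((hf.comp measurable_fst).mul (hf.comp measurable_snd)).mul
            ((BM_CC U).comp (g := fun z : I01 × I01 => (pts (p z.1), z.2))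
            ((((measurable_of_finite pts).comp hp).comp measurable_fst).prodMk measurable_snd))
        rw [Measure.volume_eq_prod, integral_prod _ m1.integrable, integral_prod _ m2.integrable]
        apply integral_congr_ae
        filter_upwards [hae] with y hy
        apply integral_congr_ae
        filter_upwards [hy] with z hz
        simp only [hz]
      rw [e3]
      have m2 : BM (fun z : I01 × I01 => f z.1 * f z.2 * CC U (pts (p z.1)) z.2) :=
          ((hf.comp measurable_fst).mul (hf.comp measurable_snd)).mul
            ((BM_CC U).comp (g := fun z : I01 × I01 => (pts (p z.1), z.2))
            ((((measurable_of_finite pts).comp hp).comp measurable_fst).prodMk measurable_snd))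
      rw [Measure.volume_eq_prod, integral_prod_symm _ m2.integrable]
      have e4 : ∀ z, ∫ y, f y * f z * CC U (pts (p y)) z = 0 := by
        intro z
        have := class_int hp hf (fun i => f z * CC U (pts i) z)
        simp only [h0, mul_zero, Finset.sum_const_zero] at this
        rw [← this]
        congr 1
        funext y
        ring
      simp only [e4, integral_zero]
    · have m3 : BM (fun t : I01 × (I01 × I01) =>
          (U.toFun t.1 t.2.1 * f t.2.1) * (U.toFun t.1 t.2.2 * f t.2.2)) := by
        have g1 := (BM_K U).comp (g := fun t : I01 × (I01 × I01) => (t.1, t.2.1)) (by fun_prop)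
        have g2 := (BM_K U).comp (g := fun t : I01 × (I01 × I01) => (t.1, t.2.2)) (by fun_prop)
        have g3 := hf.comp (g := fun t : I01 × (I01 × I01) => t.2.1) (by fun_prop)
        have g4 := hf.comp (g := fun t : I01 × (I01 × I01) => t.2.2) (by fun_prop)
        exact (g1.mul g3).mul (g2.mul g4)
      exact m3.integrable
  rw [integral_eq_zero_iff_of_nonneg (fun y => mul_self_nonneg _) hTT.integrable] at key
  filter_upwards [key] with w hw
  exact mul_self_eq_zero.1 hw

lemma partB (U : GKernel) (n : ℕ)
    (h : ∀ᵐ x : Fin (n+1) → I01, ∃ i j, i < j ∧ dd U (x i) (x j) = 0) :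
    ∃ m, m ≤ n ∧ ∃ pts : Fin m → I01, ∀ᵐ y, ∃ i, dd U (pts i) y = 0 := by
  induction n with
  | zero =>
    exfalso
    obtain ⟨x, i, j, hij, _⟩ := h.exists
    have : i = j := by apply Fin.ext; omega
    exact absurd this hij.ne
  | succ n ih =>
    by_cases h' : ∀ᵐ x : Fin (n+1) → I01, ∃ i j, i < j ∧ dd U (x i) (x j) = 0
    · obtain ⟨m, hm, pts, hp⟩ := ih h'
      exact ⟨m, by omega, pts, hp⟩
    · have hmp := (volume_preserving_piFinSuccAbove (fun _ : Fin (n+2) => I01) (Fin.last (n+1))).symm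
      have h1 := hmp.quasiMeasurePreserving.ae h
      have h2 := (Measure.measurePreserving_swap (μ := (volume : Measure (Fin (n+1) → I01)))
        (ν := (volume : Measure I01))).quasiMeasurePreserving.ae h1
      have h3 := Measure.ae_ae_of_ae_prod h2
      have h4 := (Filter.not_eventually.1 h').and_eventually h3
      obtain ⟨x, hx, hy⟩ := h4.exists
      refine ⟨n+1, le_rfl, x, ?_⟩
      filter_upwards [hy] with y hy
      obtain ⟨i, j, hij, hd⟩ := hy
      simp only [MeasurableEquiv.piFinSuccAbove_symm_apply, Prod.swap, Fin.insertNthEquiv_last] at hd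
      induction i using Fin.lastCases with
      | last => exact absurd hij (not_lt.2 (Fin.le_last j))
      | cast i =>
        induction j using Fin.lastCases with
        | last =>
          refine ⟨i, ?_⟩
          simpa using hd
        | cast j =>
          exact absurd ⟨i, j, by simpa using hij, by simpa using hd⟩ hx

lemma partC (U : GKernel) (m : ℕ) (pts : Fin m → I01) (h : ∀ᵐ y, ∃ i, dd U (pts i) y = 0) :
    ∃ p : I01 → Fin m, Measurable p ∧ ∀ᵐ y, ∀ᵐ z, CC U y z = CC U (pts (p y)) z := by
  obtain ⟨y0, i0, _⟩ := h.exists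
  let g : (Fin m → Bool) → Fin m := fun b => if hb : ∃ i, b i = true then hb.choose else i0
  have hg : ∀ b : Fin m → Bool, (∃ i, b i = true) → b (g b) = true := by
    intro b hb
    simp only [g, dif_pos hb]
    exact hb.choose_spec
  refine ⟨fun y => g (fun i => decide (dd U (pts i) y = 0)), ?_, ?_⟩
  · refine (measurable_of_finite g).comp (measurable_pi_lambda _ fun i => ?_)
    apply measurable_to_bool
    have : (fun y => decide (dd U (pts i) y = 0)) ⁻¹' {true} = (fun y => dd U (pts i) y) ⁻¹' {0} := by
      ext y; simp
    rw [this]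
    exact ((BM_dd U).comp (g := fun y => (pts i, y)) (by fun_prop)).1 (measurableSet_singleton _)
  · filter_upwards [h] with y hy
    have := hg (fun i => decide (dd U (pts i) y = 0)) (by simpa using hy)
    have h2 := dd_zero U _ _ (of_decide_eq_true this)
    filter_upwards [h2] with z hz
    exact hz.symm

lemma class_int2 {k : ℕ} {p : I01 → Fin k} (hp : Measurable p) {F : I01 × I01 → ℝ} (hF : BM F)
    (N : Fin k → Fin k → ℝ) :
    ∫ z, F z * N (p z.1) (p z.2)
      = ∑ i, ∑ j, N i j * ∫ z : I01 × I01, (if p z.1 = i ∧ p z.2 = j then F z else 0) := by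
  have h1 : ∀ i j, BM (fun z : I01 × I01 => (if p z.1 = i ∧ p z.2 = j then F z else 0)) := by
    intro i j
    have := (hF.mul ((BM_fin hp (fun l => if l = i then (1 : ℝ) else 0)).comp measurable_fst)).mul
      ((BM_fin hp (fun l => if l = j then (1 : ℝ) else 0)).comp measurable_snd)
    convert this using 2 with z
    by_cases h : p z.1 = i <;> by_cases h' : p z.2 = j <;> simp [h, h']
  simp only [← integral_const_mul]
  have h2 : ∀ i j, Integrable (fun z : I01 × I01 =>
      N i j * (if p z.1 = i ∧ p z.2 = j then F z else 0)) := fun i j =>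
    (h1 i j).integrable.const_mul _
  have e : ∀ i, ∑ j, ∫ z : I01 × I01, N i j * (if p z.1 = i ∧ p z.2 = j then F z else 0)
      = ∫ z : I01 × I01, ∑ j, N i j * (if p z.1 = i ∧ p z.2 = j then F z else 0) := by
    intro i
    rw [integral_finsetSum]
    intro j _
    exact h2 i j
  simp only [e]
  rw [← integral_finsetSum]
  · congr 1
    funext z
    rw [Finset.sum_eq_single (p z.1), Finset.sum_eq_single (p z.2)]
    · simp [mul_comm]
    · intro j _ hj; simp [hj.symm]
    · simp
    · intro i _ hi; simp [hi.symm]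
    · simp
  · intro i _
    exact integrable_finset_sum _ fun j _ => h2 i j

def bf (U : GKernel) (f g : I01 → ℝ) : ℝ := ∫ z : I01 × I01, U.toFun z.1 z.2 * (f z.1 * g z.2)

lemma bf_BM (U : GKernel) {f g : I01 → ℝ} (hf : BM f) (hg : BM g) :
    BM (fun z : I01 × I01 => U.toFun z.1 z.2 * (f z.1 * g z.2)) :=
  (BM_K U).mul ((hf.comp measurable_fst).mul (hg.comp measurable_snd))

lemma bf_symm (U : GKernel) (f g : I01 → ℝ) : bf U f g = bf U g f := by
  unfold bf
  have h := (Measure.measurePreserving_swap (μ := (volume : Measure I01))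
        (ν := (volume : Measure I01)))
  have := h.integral_comp (MeasurableEquiv.prodComm (α := I01) (β := I01)).measurableEmbedding
    (fun z : I01 × I01 => U.toFun z.1 z.2 * (f z.1 * g z.2))
  rw [Measure.volume_eq_prod, ← this]
  congr 1
  funext z
  simp only [Prod.fst_swap, Prod.snd_swap]
  rw [U.symm', mul_comm (f _)]

lemma bf_zero (U : GKernel) {k : ℕ} {p : I01 → Fin k} (hp : Measurable p) (pts : Fin k → I01)
    (hae : ∀ᵐ y, ∀ᵐ z, CC U y z = CC U (pts (p y)) z) {f g : I01 → ℝ} (hf : BM f) (hg : BM g)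
    (h0 : ∀ i, ∫ y, (if p y = i then f y else 0) = 0) : bf U g f = 0 := by
  unfold bf
  rw [Measure.volume_eq_prod, integral_prod _ (bf_BM U hg hf).integrable]
  rw [integral_eq_zero_of_ae]
  filter_upwards [T_zero U hp pts hae hf h0] with w hw
  have : ∀ y, U.toFun w y * (g w * f y) = g w * (U.toFun w y * f y) := fun y => by ring
  simp only [this, integral_const_mul, hw, mul_zero, Pi.zero_apply]

def avg {k : ℕ} (p : I01 → Fin k) (g : I01 → ℝ) (i : Fin k) : ℝ :=
  (∫ y, (if p y = i then g y else 0)) / (volume : Measure I01).real (p ⁻¹' {i})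

lemma avg_zero {k : ℕ} {p : I01 → Fin k} (hp : Measurable p) {g : I01 → ℝ} (hg : BM g) (i : Fin k) :
    ∫ y, (if p y = i then (g y - avg p g (p y)) else 0) = 0 := by
  have h1 : BM (fun y => (if p y = i then g y else 0)) := by
    have := hg.mul (BM_fin hp (fun j => if j = i then (1 : ℝ) else 0))
    simpa using this
  have h2 : BM (fun y => (if p y = i then avg p g i else 0)) :=
    BM_fin hp (fun j => if j = i then avg p g i else 0)
  have e : ∀ y, (if p y = i then (g y - avg p g (p y)) else 0)
      = (if p y = i then g y else 0) - (if p y = i then avg p g i else 0) := by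
    intro y
    by_cases h : p y = i <;> simp [h]
  simp only [e]
  rw [integral_sub h1.integrable h2.integrable]
  have e2 : ∫ y, (if p y = i then avg p g i else 0)
      = (volume : Measure I01).real (p ⁻¹' {i}) * avg p g i := by
    have : (fun y => (if p y = i then avg p g i else 0))
        = (p ⁻¹' {i}).indicator (fun _ => avg p g i) := by
      funext y; simp [Set.indicator_apply]
    rw [this, integral_indicator_const _ (hp (measurableSet_singleton _)), smul_eq_mul]
  rw [e2]
  unfold avg
  by_cases hz : (volume : Measure I01).real (p ⁻¹' {i}) = 0
  · rw [hz]
    have : (volume : Measure I01) (p ⁻¹' {i}) = 0 := by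
      rwa [measureReal_eq_zero_iff] at hz
    rw [integral_eq_zero_of_ae]
    · simp
    · have h3 := measure_eq_zero_iff_ae_notMem.1 this
      filter_upwards [h3] with y hy
      have : p y ≠ i := hy
      simp [this]
  · field_simp
    ring

lemma bf_avg (U : GKernel) {k : ℕ} {p : I01 → Fin k} (hp : Measurable p) (pts : Fin k → I01)
    (hae : ∀ᵐ y, ∀ᵐ z, CC U y z = CC U (pts (p y)) z) {f g : I01 → ℝ} (hf : BM f) (hg : BM g) :
    bf U f g = bf U f (fun y => avg p g (p y)) := by
  have h := bf_zero U hp pts hae (hg.sub (BM_fin hp (avg p g))) hf (avg_zero hp hg)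
  have e : bf U f (fun y => g y - avg p g (p y)) = bf U f g - bf U f (fun y => avg p g (p y)) := by
    unfold bf
    rw [← integral_sub (bf_BM U hf hg).integrable (bf_BM U hf (BM_fin hp (avg p g))).integrable]
    congr 1
    funext z
    ring
  rw [e] at h
  linarith

def kk (U : GKernel) {k : ℕ} (p : I01 → Fin k) (i j : Fin k) : ℝ :=
  ∫ z : I01 × I01, (if p z.1 = i ∧ p z.2 = j then U.toFun z.1 z.2 else 0)

def MM (U : GKernel) {k : ℕ} (p : I01 → Fin k) (i j : Fin k) : ℝ :=
  kk U p i j / ((volume : Measure I01).real (p ⁻¹' {i}) * (volume : Measure I01).real (p ⁻¹' {j}))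

lemma kk_symm (U : GKernel) {k : ℕ} (p : I01 → Fin k) (i j : Fin k) : kk U p i j = kk U p j i := by
  have := bf_symm U (fun x => if p x = i then 1 else 0) (fun x => if p x = j then 1 else 0)
  unfold bf at this
  unfold kk
  convert this using 3 with z z
  · by_cases h : p z.1 = i <;> by_cases h' : p z.2 = j <;> simp [h, h']
  · by_cases h : p z.1 = j <;> by_cases h' : p z.2 = i <;> simp [h, h']

lemma bf_MM (U : GKernel) {k : ℕ} {p : I01 → Fin k} (hp : Measurable p) (pts : Fin k → I01)
    (hae : ∀ᵐ y, ∀ᵐ z, CC U y z = CC U (pts (p y)) z) {f g : I01 → ℝ} (hf : BM f) (hg : BM g) :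
    bf U f g = ∫ z : I01 × I01, (f z.1 * g z.2) * MM U p (p z.1) (p z.2) := by
  rw [bf_avg U hp pts hae hf hg, bf_symm, bf_avg U hp pts hae (BM_fin hp (avg p g)) hf, bf_symm]
  unfold bf
  rw [class_int2 hp (BM_K U) (fun i j => avg p f i * avg p g j),
    class_int2 hp ((hf.comp measurable_fst).mul (hg.comp measurable_snd)) (MM U p)]
  refine Finset.sum_congr rfl fun i _ => Finset.sum_congr rfl fun j _ => ?_
  have e : ∫ z : I01 × I01, (if p z.1 = i ∧ p z.2 = j then f z.1 * g z.2 else 0)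
      = (∫ y, (if p y = i then f y else 0)) * (∫ y, (if p y = j then g y else 0)) := by
    rw [← integral_prod_mul]
    rw [Measure.volume_eq_prod]
    congr 1
    funext z
    by_cases h : p z.1 = i <;> by_cases h' : p z.2 = j <;> simp [h, h']
  rw [e]
  unfold MM avg
  change _ * kk U p i j = _
  ring

lemma partE (U : GKernel) (hU : U.IsGraphon) {k : ℕ} {p : I01 → Fin k} (hp : Measurable p)
    (pts : Fin k → I01) (hae : ∀ᵐ y, ∀ᵐ z, CC U y z = CC U (pts (p y)) z) :
    ∃ M : Fin k → Fin k → ℝ, (∀ i j, M i j = M j i) ∧ IsRep U p M := by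
  refine ⟨MM U p, fun i j => by unfold MM; rw [kk_symm, mul_comm], ?_⟩
  have hM0 : ∀ i j, 0 ≤ MM U p i j := by
    intro i j
    unfold MM kk
    refine div_nonneg (integral_nonneg fun z => ?_) (by positivity)
    dsimp only
    split_ifs
    · exact (hU _ _).1
    · exact le_rfl
  have bM : BM (fun z : I01 × I01 => MM U p (p z.1) (p z.2)) := by
    have m : Measurable (fun z : I01 × I01 => (p z.1, p z.2)) :=
      (hp.comp measurable_fst).prodMk (hp.comp measurable_snd)
    refine ⟨(measurable_of_finite (fun t : Fin k × Fin k => MM U p t.1 t.2)).comp m,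
      ∑ t : Fin k × Fin k, |MM U p t.1 t.2|, fun z => ?_⟩
    exact Finset.single_le_sum (f := fun t : Fin k × Fin k => |MM U p t.1 t.2|)
      (fun _ _ => abs_nonneg _) (Finset.mem_univ (p z.1, p z.2))
  unfold IsRep
  have key : ∀ F : I01 × I01 → ℝ, BM F → (∀ z, 0 ≤ F z) → ∀ R Q : Set I01, MeasurableSet R →
      MeasurableSet Q → (volume.withDensity (fun z => ENNReal.ofReal (F z))) (R ×ˢ Q)
        = ENNReal.ofReal (∫ z, (R.indicator 1 z.1 * Q.indicator 1 z.2) * F z) := by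
    intro F hF hF0 R Q hR hQ
    rw [withDensity_apply _ (hR.prod hQ),
      ← ofReal_integral_eq_lintegral_ofReal hF.integrable
        (Filter.Eventually.of_forall hF0), ← integral_indicator (hR.prod hQ)]
    congr 2
    funext z
    by_cases h : z.1 ∈ R <;> by_cases h' : z.2 ∈ Q <;> simp [h, h', Set.indicator_apply]
  have hind : ∀ R : Set I01, MeasurableSet R → BM (R.indicator (1 : I01 → ℝ)) := by
    intro R hR
    refine ⟨measurable_one.indicator hR, 1, fun x => ?_⟩
    by_cases h : x ∈ R <;> simp [h]
  have hfin : ∀ F : I01 × I01 → ℝ, BM F → (∀ z, 0 ≤ F z) →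
      ∫⁻ z, ENNReal.ofReal (F z) ≠ ⊤ := by
    intro F hF hF0
    rw [← ofReal_integral_eq_lintegral_ofReal hF.integrable (Filter.Eventually.of_forall hF0)]
    exact ENNReal.ofReal_ne_top
  have h1 : (volume : Measure (I01 × I01)).withDensity
        (fun z => ENNReal.ofReal (U.toFun z.1 z.2))
      = volume.withDensity (fun z => ENNReal.ofReal (MM U p (p z.1) (p z.2))) := by
    have : IsFiniteMeasure ((volume : Measure (I01 × I01)).withDensity
        (fun z => ENNReal.ofReal (U.toFun z.1 z.2))) :=
      isFiniteMeasure_withDensity (hfin _ (BM_K U) fun z => (hU _ _).1)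
    refine Measure.ext_prod ?_
    intro R Q hR hQ
    rw [key _ (BM_K U) (fun z => (hU _ _).1) R Q hR hQ, key _ bM (fun z => hM0 _ _) R Q hR hQ,
      ← bf_MM U hp pts hae (hind R hR) (hind Q hQ)]
    unfold bf
    congr 2
    funext z
    ring
  rw [withDensity_eq_iff (BM_K U).1.ennreal_ofReal.aemeasurable
    bM.1.ennreal_ofReal.aemeasurable (hfin _ (BM_K U) fun z => (hU _ _).1)] at h1
  filter_upwards [h1] with z hz
  exact (ENNReal.ofReal_eq_ofReal_iff (hU _ _).1 (hM0 _ _)).1 hz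

lemma int_sum {α β : Type} [Fintype α] [Fintype β] (F : (α ⊕ β → I01) → ℝ) (hF : Integrable F) :
    ∫ x, F x = ∫ a : α → I01, ∫ b : β → I01, F (Sum.elim a b) ∧
    Integrable (fun a : α → I01 => ∫ b : β → I01, F (Sum.elim a b)) := by
  have h := (volume_measurePreserving_sumPiEquivProdPi (fun _ : α ⊕ β => I01)).symm
  have e : ∀ z, (MeasurableEquiv.sumPiEquivProdPi (fun _ : α ⊕ β => I01)).symm z
      = Sum.elim z.1 z.2 := by
    intro z
    funext v
    cases v <;> rfl
  have hi : Integrable (fun z : (α → I01) × (β → I01) => F (Sum.elim z.1 z.2)) := by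
    have := h.integrable_comp_of_integrable hF
    simpa only [Function.comp_def, e] using this
  constructor
  · rw [← h.integral_comp (MeasurableEquiv.measurableEmbedding _)]
    simp only [e]
    exact integral_prod _ hi
  · exact Integrable.integral_prod_left hi

abbrev VA (n : ℕ) : Type := (Fin n ⊕ Pr n) ⊕ (Pr n × Bool)

def FA (n : ℕ) (v : Sym2 (VA n) → ℝ) : ℝ :=
  ∏ r : Pr n × Bool, (v s(.inl (.inl r.1.1.1), .inr r) - v s(.inl (.inl r.1.1.2), .inr r))
    * v s(.inl (.inr r.1), .inr r)

lemma FA_mem (n : ℕ) : FA n ∈ MLs {e : Sym2 (VA n) | ¬ e.IsDiag} := by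
  unfold FA
  have h := MLs_prod (V := VA n) (Finset.univ : Finset (Pr n × Bool))
    (fun r => {e : Sym2 (VA n) | ∃ u, e = s(.inl u, .inr r)})
    (fun r v => (v s(.inl (.inl r.1.1.1), .inr r) - v s(.inl (.inl r.1.1.2), .inr r))
    * v s(.inl (.inr r.1), .inr r)) ?_ ?_
  · refine MLs_mono ?_ h
    intro e he
    simp only [Set.mem_iUnion] at he
    obtain ⟨r, _, u, rfl⟩ := he
    simp
  · intro r _
    refine MLs_mono ?_ (MLs_mul ?_ (MLs_sub _ _) (MLs_var _))
    · rintro e ((rfl | rfl) | rfl)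
      · exact ⟨_, rfl⟩
      · exact ⟨_, rfl⟩
      · exact ⟨_, rfl⟩
    · rw [Set.disjoint_left]
      rintro e (rfl | rfl) h <;> simp at h
  · intro r _ r' _ hr
    rw [Set.disjoint_left]
    rintro e ⟨u, rfl⟩ ⟨u', h⟩
    simp at h
    exact hr h.2

lemma FA_int (U : GKernel) (n : ℕ) :
    ∫ x : VA n → I01, FA n (ev U.toFun U.symm' x)
      = ∫ x : Fin n → I01, ∏ p : Pr n, dd U (x p.1.1) (x p.1.2) := by
  obtain ⟨h1, h2⟩ := int_sum _ (MLs_integrable U _ _ (FA_mem n))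
  rw [h1]
  have e1 : ∀ a : Fin n ⊕ Pr n → I01,
      ∫ b : Pr n × Bool → I01, FA n (ev U.toFun U.symm' (Sum.elim a b))
      = ∏ p : Pr n, (CC U (a (.inl p.1.1)) (a (.inr p)) - CC U (a (.inl p.1.2)) (a (.inr p))) ^ 2 := by
    intro a
    unfold FA
    simp only [ev_mk, Sum.elim_inl, Sum.elim_inr]
    rw [integral_fintype_prod_volume_eq_prod (𝕜 := ℝ) (ι := Pr n × Bool) (E := fun _ => I01)
      (f := fun (r : Pr n × Bool) (w : I01) =>
      (U.toFun (a (.inl r.1.1.1)) w - U.toFun (a (.inl r.1.1.2)) w) * U.toFun (a (.inr r.1)) w)]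
    have e2 : ∀ p : Pr n, ∫ w, (U.toFun (a (.inl p.1.1)) w - U.toFun (a (.inl p.1.2)) w)
        * U.toFun (a (.inr p)) w
        = CC U (a (.inl p.1.1)) (a (.inr p)) - CC U (a (.inl p.1.2)) (a (.inr p)) := by
      intro p
      unfold CC
      have hb : ∀ x y : I01, BM (fun w => U.toFun x w * U.toFun w y) := fun x y =>
        ((BM_K U).comp (g := fun w => (x, w)) (by fun_prop)).mul
        ((BM_K U).comp (g := fun w => (w, y)) (by fun_prop))
      rw [← integral_sub (hb _ _).integrable (hb _ _).integrable]
      congr 1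
      funext w
      rw [U.symm' (a (.inr p)) w]
      ring
    simp only [e2]
    rw [Fintype.prod_prod_type]
    simp
  simp only [e1] at h2 ⊢
  obtain ⟨h3, -⟩ := int_sum _ h2
  rw [h3]
  congr 1
  funext x
  simp only [Sum.elim_inl, Sum.elim_inr]
  rw [integral_fintype_prod_volume_eq_prod (𝕜 := ℝ) (ι := Pr n) (E := fun _ => I01)
    (f := fun (p : Pr n) (y : I01) => (CC U (x p.1.1) y - CC U (x p.1.2) y) ^ 2)]
  rfl

lemma card_VA (q : ℕ) (hq : 2 ≤ q) : Fintype.card (VA (q+1)) ≤ 4 * q ^ 2 - q := by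
  have h := card_lt_pairs (q := q + 1) (fun i => -((i : ℕ) : ℝ))
  have e : Fintype.card {p : Fin (q+1) × Fin (q+1) // -((p.2 : ℕ) : ℝ) < -((p.1 : ℕ) : ℝ)}
      = Fintype.card (Pr (q+1)) := by
    refine Fintype.card_congr (Equiv.subtypeEquivRight fun p => ?_)
    simp
  rw [e] at h
  have hc : Fintype.card (VA (q+1)) = (q + 1 + Fintype.card (Pr (q+1))) + Fintype.card (Pr (q+1)) * 2 := by
    simp only [VA, Fintype.card_sum, Fintype.card_prod, Fintype.card_bool, Fintype.card_fin]
  rw [hc]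
  have : 4 * q ^ 2 ≥ 8 * q := by nlinarith
  apply Nat.le_sub_of_add_le
  nlinarith

lemma partA (q : ℕ) (hq : 2 ≤ q) (W W' : GKernel) (π : I01 → Fin q) (A : Fin q → Fin q → ℝ)
    (hW : ∀ x y, W.toFun x y = A (π x) (π y))
    (hagree : ∀ n : ℕ, n ≤ 4 * q ^ 2 - q → ∀ H : SimpleGraph (Fin n),
      homDensity H W' = homDensity H W) :
    ∀ᵐ x : Fin (q+1) → I01, ∃ i j, i < j ∧ dd W' (x i) (x j) = 0 := by
  have h := MLs_agree _ W W' hagree (VA (q+1)) (card_VA q hq) _ (FA_mem (q+1))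
  have h0 : ∀ x : VA (q+1) → I01, FA (q+1) (ev W.toFun W.symm' x) = 0 := by
    intro x
    obtain ⟨i, j, hij, he⟩ := Fintype.exists_ne_map_eq_of_card_lt
      (fun i : Fin (q+1) => π (x (.inl (.inl i)))) (by simp)
    have : ∃ p : Pr (q+1), π (x (.inl (.inl p.1.1))) = π (x (.inl (.inl p.1.2))) := by
      rcases lt_or_gt_of_ne hij with h | h
      · exact ⟨⟨(i, j), h⟩, he⟩
      · exact ⟨⟨(j, i), h⟩, he.symm⟩
    obtain ⟨p, hp⟩ := this
    unfold FA
    refine Finset.prod_eq_zero (Finset.mem_univ (p, true)) ?_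
    simp only [ev_mk, hW, hp, sub_self, zero_mul]
  simp only [h0, integral_zero] at h
  rw [FA_int] at h
  have hb : BM (fun x : Fin (q+1) → I01 => ∏ p : Pr (q+1), dd W' (x p.1.1) (x p.1.2)) := by
    obtain ⟨hm, C, hC⟩ := BM_dd W'
    refine ⟨Finset.measurable_prod _ fun p _ => ?_, ∏ p : Pr (q+1), C, fun x => ?_⟩
    · have m2 : Measurable (fun x : Fin (q+1) → I01 => (x p.1.1, x p.1.2)) :=
        (measurable_pi_apply p.1.1).prodMk (measurable_pi_apply p.1.2)
      exact hm.comp m2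
    · rw [Finset.abs_prod]
      exact Finset.prod_le_prod (fun _ _ => abs_nonneg _) (fun p _ => hC (x p.1.1, x p.1.2))
  have hnn : ∀ x x', 0 ≤ dd W' x x' := fun x x' => integral_nonneg fun y => sq_nonneg _
  rw [integral_eq_zero_iff_of_nonneg (fun x => Finset.prod_nonneg fun p _ =>
    hnn _ _) hb.integrable] at h
  filter_upwards [h] with x hx
  obtain ⟨p, _, hp⟩ := Finset.prod_eq_zero_iff.1 hx
  exact ⟨p.1.1, p.1.2, p.2, hp⟩

lemma wmodel (q : ℕ) (W : GKernel) (hstep : IsStepKernel W q) :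
    ∃ (π : I01 → Fin q) (A : Fin q → Fin q → ℝ), Measurable π ∧ (∀ i j, A i j = A j i) ∧
      (∀ x y, W.toFun x y = A (π x) (π y)) ∧
      (∀ i, 0 < (volume : Measure I01).real (π ⁻¹' {i})) ∧
      ∀ l j, l ≠ j → ∃ i, A l i ≠ A j i := by
  obtain ⟨⟨D, hm, hpos, hdisj, hun, hc⟩, hno⟩ := hstep
  have hex : ∀ x, ∃ i, x ∈ D i := by
    intro x
    have : x ∈ ⋃ i, D i := by rw [hun]; trivial
    simpa using this
  choose π hπ using hex
  have hpre : ∀ i, π ⁻¹' {i} = D i := by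
    intro i
    ext x
    simp only [Set.mem_preimage, Set.mem_singleton_iff]
    constructor
    · rintro rfl; exact hπ x
    · intro hx
      by_contra hne
      exact Set.disjoint_left.1 (hdisj hne) (hπ x) hx
  choose A hA using hc
  have hW : ∀ x y, W.toFun x y = A (π x) (π y) := fun x y => hA _ _ x (hπ x) y (hπ y)
  have hne : ∀ i, ∃ x, π x = i := by
    intro i
    obtain ⟨x, hx⟩ := nonempty_of_measure_ne_zero (hpos i).ne'
    rw [← hpre] at hx
    exact ⟨x, hx⟩
  have hmeas : Measurable π := measurable_to_countable' fun i => by rw [hpre]; exact hm i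
  refine ⟨π, A, hmeas, ?_, hW, ?_, ?_⟩
  · intro i j
    obtain ⟨x, rfl⟩ := hne i
    obtain ⟨y, rfl⟩ := hne j
    rw [← hW, ← hW, W.symm']
  · intro i
    rw [hpre]
    exact ENNReal.toReal_pos (hpos i).ne' (measure_ne_top _ _)
  · have hsym : ∀ i j, A i j = A j i := by
      intro i j
      obtain ⟨x, rfl⟩ := hne i
      obtain ⟨y, rfl⟩ := hne j
      rw [← hW, ← hW, W.symm']
    intro l j hlj
    by_contra hcon
    push Not at hcon
    apply hno
    let τ : Fin q → {a : Fin q // a ≠ j} := fun a => if h : a = j then ⟨l, hlj⟩ else ⟨a, h⟩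
    have hτ : ∀ a b, A a b = A (τ a).1 b := by
      intro a b
      by_cases h : a = j
      · simp only [τ, dif_pos h, h]; exact (hcon b).symm
      · simp only [τ, dif_neg h]
    have hτ2 : ∀ a b, A a b = A (τ a).1 (τ b).1 := by
      intro a b
      rw [hτ a b, hsym, hτ b, hsym]
    have hcard : Fintype.card {a : Fin q // a ≠ j} = q - 1 := by
      simp
    let e := Fintype.equivFinOfCardEq hcard
    refine ⟨fun m => {x | e (τ (π x)) = m}, ?_, ?_, ?_, ?_, ?_⟩
    · intro m
      have : Measurable (fun x => e (τ (π x))) := (measurable_of_finite (fun a => e (τ a))).comp hmeas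
      exact this (measurableSet_singleton m)
    · intro m
      refine lt_of_lt_of_le (hpos (e.symm m).1) (measure_mono ?_)
      rw [← hpre]
      intro x hx
      have hx' : π x = (e.symm m).1 := hx
      have : τ (π x) = e.symm m := by
        rw [hx']
        simp only [τ, dif_neg (e.symm m).2]
      simp [this]
    · intro m m' hmm
      rw [Set.disjoint_left]
      intro x h1 h2
      exact hmm (h1.symm.trans h2)
    · ext x; simp
    · intro m m'
      refine ⟨A (e.symm m).1 (e.symm m').1, ?_⟩
      rintro x rfl y rfl
      rw [hW, hτ2]
      simp

lemma fsum_lin {q k : ℕ} (V : Type) [Fintype V] (α : Fin q → ℝ) (A : Fin q → Fin q → ℝ)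
    (hA : ∀ i j, A i j = A j i) (β : Fin k → ℝ) (B : Fin k → Fin k → ℝ) (hB : ∀ i j, B i j = B j i)
    (h : ∀ S : Finset (Sym2 V), (∀ e ∈ S, ¬ e.IsDiag) →
      fsum V α A hA (fun v => ∏ e ∈ S, v e) = fsum V β B hB (fun v => ∏ e ∈ S, v e))
    (f : (Sym2 V → ℝ) → ℝ) (hf : f ∈ MLs {e | ¬ e.IsDiag}) :
    fsum V α A hA f = fsum V β B hB f := by
  induction hf using Submodule.span_induction with
  | mem f hf =>
    obtain ⟨S, hS, rfl⟩ := hf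
    exact h S (fun e he => hS he)
  | zero => simp [fsum]
  | add f g hf hg ihf ihg =>
    unfold fsum at ihf ihg ⊢
    simp only [Pi.add_apply, mul_add, Finset.sum_add_distrib, ihf, ihg]
  | smul c f hf ih =>
    unfold fsum at ih ⊢
    simp only [Pi.smul_apply, smul_eq_mul, mul_left_comm _ c, ← Finset.mul_sum, ih]

lemma fsum_reindex {q k : ℕ} (V : Type) [Fintype V] (α : Fin q → ℝ) (A : Fin q → Fin q → ℝ)
    (hA : ∀ i j, A i j = A j i) (β : Fin k → ℝ) (B : Fin k → Fin k → ℝ) (hB : ∀ i j, B i j = B j i)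
    (σ : Fin q ≃ Fin k) (h1 : ∀ i, β (σ i) = α i) (h2 : ∀ i j, B (σ i) (σ j) = A i j)
    (f : (Sym2 V → ℝ) → ℝ) :
    fsum V α A hA f = fsum V β B hB f := by
  unfold fsum
  refine Fintype.sum_equiv ((Equiv.refl V).arrowCongr σ) _ _ fun φ => ?_
  congr 1
  · exact Finset.prod_congr rfl fun v _ => (h1 (φ v)).symm
  · congr 1
    funext e
    induction e using Sym2.ind with
    | _ u v => exact (h2 (φ u) (φ v)).symm

theorem statement0 (q : ℕ) (hq : 2 ≤ q) (W W' : GKernel)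
    (hWg : W.IsGraphon) (hW'g : W'.IsGraphon)
    (hstep : IsStepKernel W q)
    (hagree : ∀ n : ℕ, n ≤ 4 * q ^ 2 - q → ∀ H : SimpleGraph (Fin n),
      homDensity H W' = homDensity H W) :
    WeaklyIsomorphic W W' := by
  obtain ⟨π, A, hπ, hA, hW, hpos, htw⟩ := wmodel q W hstep
  obtain ⟨k, hk, pts, hpts⟩ := partB W' q (partA q hq W W' π A hW hagree)
  obtain ⟨p, hp, hae⟩ := partC W' k pts hpts
  obtain ⟨B, hB, hrep⟩ := partE W' hW'g hp pts hae
  have hrepW : IsRep W π A := Filter.Eventually.of_forall fun z => hW _ _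
  obtain ⟨σ, h1, h2⟩ := finite_main hq hk _ A hA hpos (rep_sum π hπ) htw _ B hB (rep_sum p hp) (by
    intro V _ hV f hf
    refine fsum_lin V _ A hA _ B hB ?_ f hf
    intro S hS
    rw [← rep_mdens W π hπ A hA hrepW V S hS, ← rep_mdens W' p hp B hB hrep V S hS]
    exact (mdens_agree _ W W' hagree V hV S hS).symm)
  intro n H
  rw [homDensity_eq_mdens, homDensity_eq_mdens]
  have hS : ∀ e ∈ (Set.toFinite H.edgeSet).toFinset, ¬ e.IsDiag := by
    intro e he
    rw [Set.Finite.mem_toFinset] at he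
    exact H.not_isDiag_of_mem_edgeSet he
  rw [rep_mdens W π hπ A hA hrepW _ _ hS, rep_mdens W' p hp B hB hrep _ _ hS]
  exact fsum_reindex _ _ A hA _ B hB σ h1 h2 _

end
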